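/- Let 0 ≤ γ < 1 and suppose the complex scalar field φ vanishes at null infinity, i.e. lim_{v→∞} φ(u,v,ω) = 0 for all u, ω. Then there is a constant C depending only on γ and R such that for all u ∈ ℝ, ∫_{H_u} r^γ|φ|² dv dω ≤ C( ∫_{S²} r^{1+γ}|φ|²(u, v(u), ω) dω + ∫_{H_u} r^γ|D_L(rφ)|² dv dω ), where v(u) = −u if u ≤ −R/2 and v(u) = 2R + u if u > −R/2. In particular ∫_{H_u}|φ|² dv dω ≤ C·E[φ](H_u) and ∫_{Σ_τ}|φ|² dv′ dω ≤ C·E[φ](Σ_τ), where v′ = v when r ≥ R and v′ = r when r ≤ R. -/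

import Mathlib

/-!  Common setup: Minkowski space ℝ^{3+1}, null frame, Maxwell–Klein–Gordon objects. -/

noncomputable section

open MeasureTheory ENNReal Set Metric

/-- spacetime points of ℝ^{3+1} -/
abbrev V : Type := Fin 4 → ℝ
/-- spatial points -/
abbrev E3 : Type := EuclideanSpace ℝ (Fin 3)

namespace MKG

def oR (x : ℝ) : ℝ≥0∞ := ENNReal.ofReal x

/-! ## Coordinates -/
def tC (p : V) : ℝ := p 0
def rad (p : V) : ℝ := Real.sqrt (∑ i : Fin 3, (p i.succ) ^ 2)
def uC (p : V) : ℝ := (tC p - rad p) / 2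
def vC (p : V) : ℝ := (tC p + rad p) / 2
def rplus (p : V) : ℝ := 1 + rad p
def uplus (p : V) : ℝ := 1 + |uC p|
def taupl (τ : ℝ) : ℝ := 1 + |τ|
/-- Minkowski metric diag(-1,1,1,1) (diagonal entries). -/
def eta : Fin 4 → ℝ := fun μ => if μ = 0 then -1 else 1

/-- spacetime point from time and space -/
def stp (t : ℝ) (x : E3) : V := ![t, x 0, x 1, x 2]
/-- spacetime point from time, radius and angle -/
def pt (t r : ℝ) (ω : E3) : V := ![t, r * ω 0, r * ω 1, r * ω 2]

/-! ## Derivatives, connection, curvature -/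
def pd (μ : Fin 4) (f : V → ℝ) (p : V) : ℝ := fderiv ℝ f p (Pi.single μ 1)
def pdC (μ : Fin 4) (f : V → ℂ) (p : V) : ℂ := fderiv ℝ f p (Pi.single μ 1)

/-- covariant derivative D_μ = ∂_μ + i A_μ -/
def covD (A : V → Fin 4 → ℝ) (μ : Fin 4) (φ : V → ℂ) (p : V) : ℂ :=
  pdC μ φ p + Complex.I * (A p μ) * φ p
/-- second covariant derivative D_μ D_ν φ -/
def covD2 (A : V → Fin 4 → ℝ) (μ ν : Fin 4) (φ : V → ℂ) (p : V) : ℂ :=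
  pdC μ (covD A ν φ) p + Complex.I * (A p μ) * covD A ν φ p
/-- covariant wave operator □_A = D^μ D_μ -/
def boxA (A : V → Fin 4 → ℝ) (φ : V → ℂ) (p : V) : ℂ :=
  ∑ μ, (eta μ : ℂ) * covD2 A μ μ φ p
/-- curvature 2-form F = dA -/
def curv (A : V → Fin 4 → ℝ) (p : V) (μ ν : Fin 4) : ℝ :=
  pd μ (fun q => A q ν) p - pd ν (fun q => A q μ) p

/-- (δG)_ν = ∂^μ G_{μν} (divergence over the first index) -/
def divFst (G : V → Fin 4 → Fin 4 → ℝ) (p : V) (ν : Fin 4) : ℝ :=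
  ∑ μ, eta μ * pd μ (fun q => G q μ ν) p
/-- J_μ = ∂^ν G_{μν} (divergence over the second index) -/
def divSnd (G : V → Fin 4 → Fin 4 → ℝ) (p : V) (μ : Fin 4) : ℝ :=
  ∑ ν, eta ν * pd ν (fun q => G q μ ν) p

/-! ## Null frame and null decompositions -/
/-- outgoing null vector L = ∂_t + ∂_r -/
def Lv (p : V) : V := ![1, p 1 / rad p, p 2 / rad p, p 3 / rad p]
/-- incoming null vector L̲ = ∂_t − ∂_r -/
def Lbv (p : V) : V := ![1, -(p 1 / rad p), -(p 2 / rad p), -(p 3 / rad p)]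
/-- radial vector ∂_r -/
def rv (p : V) : V := ![0, p 1 / rad p, p 2 / rad p, p 3 / rad p]
/-- tangential projection frame P_j = ∂_j − ω_j ∂_r (spanning the spheres'
tangent space; for any covector ξ one has Σ_j ξ(P_j)² = |ξ restricted to the sphere|²). -/
def Pv (p : V) (j : Fin 3) : V :=
  fun μ => if μ = 0 then 0 else
    (if μ = j.succ then 1 else 0) - p j.succ * p μ / rad p ^ 2

/-- evaluation of a 2-form on two vectors -/
def ap2 (G : V → Fin 4 → Fin 4 → ℝ) (X Y : V) (p : V) : ℝ := ∑ μ, ∑ ν, X μ * Y ν * G p μ ν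
/-- evaluation of a 1-form on a vector -/
def ap1 (J : V → Fin 4 → ℝ) (X : V) (p : V) : ℝ := ∑ μ, X μ * J p μ

/-- |α|² = Σ_i F(L,e_i)² -/
def alphaSq (G : V → Fin 4 → Fin 4 → ℝ) (p : V) : ℝ := ∑ j : Fin 3, (ap2 G (Lv p) (Pv p j) p) ^ 2
/-- |α̲|² = Σ_i F(L̲,e_i)² -/
def abarSq (G : V → Fin 4 → Fin 4 → ℝ) (p : V) : ℝ := ∑ j : Fin 3, (ap2 G (Lbv p) (Pv p j) p) ^ 2
/-- ρ = ½ F(L̲,L) -/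
def rhoC (G : V → Fin 4 → Fin 4 → ℝ) (p : V) : ℝ := (1 / 2) * ap2 G (Lbv p) (Lv p) p
/-- σ² = F(e₁,e₂)² -/
def sigmaSq (G : V → Fin 4 → Fin 4 → ℝ) (p : V) : ℝ :=
  (1 / 2) * ∑ j : Fin 3, ∑ k : Fin 3, (ap2 G (Pv p j) (Pv p k) p) ^ 2
/-- |F|², the sum of the squares of all (independent) components -/
def fSq (G : V → Fin 4 → Fin 4 → ℝ) (p : V) : ℝ := (1 / 2) * ∑ μ, ∑ ν, (G p μ ν) ^ 2
/-- squared angular part |J̸|² of a 1-form -/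
def JslashSq (J : V → Fin 4 → ℝ) (p : V) : ℝ := ∑ j : Fin 3, (ap1 J (Pv p j) p) ^ 2

/-! ## Scalar field: null derivatives and energy densities -/
/-- directional covariant derivative -/
def dirD (A : V → Fin 4 → ℝ) (X : V) (φ : V → ℂ) (p : V) : ℂ :=
  ∑ μ, (X μ : ℂ) * covD A μ φ p
/-- the weighted field ψ = rφ -/
def psi (φ : V → ℂ) (p : V) : ℂ := (rad p : ℂ) * φ p
def eDL (A : V → Fin 4 → ℝ) (φ : V → ℂ) (p : V) : ℝ := ‖dirD A (Lv p) φ p‖ ^ 2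
def eDLb (A : V → Fin 4 → ℝ) (φ : V → ℂ) (p : V) : ℝ := ‖dirD A (Lbv p) φ p‖ ^ 2
/-- |D̸φ|² -/
def eDslash (A : V → Fin 4 → ℝ) (φ : V → ℂ) (p : V) : ℝ :=
  ∑ j : Fin 3, ‖dirD A (Pv p j) φ p‖ ^ 2
/-- |Dφ|² -/
def eD (A : V → Fin 4 → ℝ) (φ : V → ℂ) (p : V) : ℝ := ∑ μ, ‖covD A μ φ p‖ ^ 2
/-- |D̄φ|² = |Dφ|² + r₊^{-2}|φ|² -/
def eDbar (A : V → Fin 4 → ℝ) (φ : V → ℂ) (p : V) : ℝ := eD A φ p + ‖φ p‖ ^ 2 / rplus p ^ 2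
/-- the covariant angular Laplacian D̸² -/
def covLapSph (A : V → Fin 4 → ℝ) (φ : V → ℂ) (p : V) : ℂ :=
  ∑ j : Fin 3, dirD A (Pv p j) (fun q => dirD A (Pv q j) φ q) p

/-- the current J_μ[φ] = Im(φ · conj(D_μ φ)) -/
def Jsf (A : V → Fin 4 → ℝ) (φ : V → ℂ) (p : V) (μ : Fin 4) : ℝ :=
  (φ p * (starRingEnd ℂ) (covD A μ φ p)).im
/-- X^μ F_{μν} J^ν[φ] -/
def FJcontr (G : V → Fin 4 → Fin 4 → ℝ) (A : V → Fin 4 → ℝ) (φ : V → ℂ)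
    (X : V → V) (p : V) : ℝ :=
  ∑ ν, (∑ μ, X p μ * G p μ ν) * (eta ν * Jsf A φ p ν)

/-! ## Integrals over spheres, null hypersurfaces and regions -/
/-- integral over the unit sphere (2-dimensional Hausdorff measure) -/
def sphLInt (f : E3 → ℝ≥0∞) : ℝ≥0∞ := ∫⁻ ω in sphere (0 : E3) 1, f ω ∂ μH[2]
/-- sphere integral of a density on the sphere of radius r at time t -/
def sphI (f : V → ℝ) (t r : ℝ) : ℝ≥0∞ := sphLInt (fun ω => oR (f (pt t r ω)))
/-- ∫_{H_u ∩ {v ≥ v₀}} f dv dω -/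
def lIntH (u v0 : ℝ) (f : V → ℝ) : ℝ≥0∞ := ∫⁻ v in Ici v0, sphI f (u + v) (v - u)
/-- ∫_{H_u ∩ {v₀ ≤ v ≤ v₁}} f dv dω -/
def lIntHseg (u v0 v1 : ℝ) (f : V → ℝ) : ℝ≥0∞ := ∫⁻ v in Icc v0 v1, sphI f (u + v) (v - u)
/-- ∫_{H̲_v ∩ {u₀ ≤ u ≤ u₁}} f du dω -/
def lIntHb (v u0 u1 : ℝ) (f : V → ℝ) : ℝ≥0∞ := ∫⁻ u in Icc u0 u1, sphI f (u + v) (v - u)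
/-- integral over the ball {|x| ≤ R'} at time t -/
def lIntBall (t R' : ℝ) (f : V → ℝ) : ℝ≥0∞ := ∫⁻ x in closedBall (0 : E3) R', oR (f (stp t x))
/-- integral over the annulus {r₀ ≤ |x| ≤ r₁} at time t -/
def lIntAnn (t r0 r1 : ℝ) (f : V → ℝ) : ℝ≥0∞ :=
  ∫⁻ x in {x : E3 | r0 ≤ ‖x‖ ∧ ‖x‖ ≤ r1}, oR (f (stp t x))
/-- integral over {|x| ≥ r₀} at time t -/
def lIntExt (t r0 : ℝ) (f : V → ℝ) : ℝ≥0∞ := ∫⁻ x in {x : E3 | r0 ≤ ‖x‖}, oR (f (stp t x))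
/-- integral over all of ℝ³ -/
def lIntE3 (f : E3 → ℝ) : ℝ≥0∞ := ∫⁻ x, oR (f x)

/-! ## The foliation Σ_τ and the regions -/
/-- the foliation parameter through a point: t in the cylinder {r ≤ R}, 2u+R outside -/
def sigP (R : ℝ) (p : V) : ℝ := if rad p ≤ R then tC p else 2 * uC p + R
def SigmaSet (R τ : ℝ) : Set V := {p | 0 ≤ tC p ∧ sigP R p = τ}
/-- interior region 𝒟_{τ₁}^{τ₂} between Σ_{τ₁} and Σ_{τ₂} -/
def Dint (R τ₁ τ₂ : ℝ) : Set V := {p | 0 ≤ tC p ∧ τ₁ ≤ sigP R p ∧ sigP R p ≤ τ₂}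
/-- 𝒟̄_{τ₁}^{τ₂} = 𝒟_{τ₁}^{τ₂} ∩ {r ≥ R} -/
def DbarInt (R τ₁ τ₂ : ℝ) : Set V := Dint R τ₁ τ₂ ∩ {p | R ≤ rad p}
/-- exterior region 𝒟_{τ₁}^{τ₂} (τ₂ ≤ τ₁ ≤ 0), the Cauchy development of
the annulus {R−τ₁ ≤ |x| ≤ R−τ₂} -/
def Dext (R τ₁ τ₂ : ℝ) : Set V :=
  {p | 0 ≤ tC p ∧ uC p ≤ (τ₁ - R) / 2 ∧ vC p ≤ -((τ₂ - R) / 2)}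
/-- 𝒟_τ : future of Σ_τ (τ ≥ 0), resp. 𝒟_τ^{-∞} (τ < 0) -/
def Dfrom (R τ : ℝ) : Set V :=
  if 0 ≤ τ then {p | 0 ≤ tC p ∧ τ ≤ sigP R p} else {p | 0 ≤ tC p ∧ uC p ≤ (τ - R) / 2}
def DbarFrom (R τ : ℝ) : Set V := Dfrom R τ ∩ {p | R ≤ rad p}
def halfSpace : Set V := {p | 0 ≤ tC p}
def regGe (R : ℝ) : Set V := {p | 0 ≤ tC p ∧ R ≤ rad p}
def regLe (R' : ℝ) : Set V := {p | 0 ≤ tC p ∧ rad p ≤ R'}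

/-- weighted spacetime norm  I^{pw}_{qw}[·](D) = ∫_D u₊^{qw} r₊^{pw} g  (g = squared magnitude) -/
def wI (pw qw : ℝ) (g : V → ℝ) (D : Set V) : ℝ≥0∞ :=
  ∫⁻ x in D, oR (uplus x ^ qw * rplus x ^ pw * g x)

/-- surface integral over Σ_τ with the measures dx (ball part) and r²dv dω (null part) -/
def lIntSigE (R τ : ℝ) (f : V → ℝ) : ℝ≥0∞ :=
  if 0 ≤ τ then lIntBall τ R f + lIntH ((τ - R) / 2) ((τ + R) / 2) (fun p => f p * rad p ^ 2)
  else lIntH ((τ - R) / 2) (-((τ - R) / 2)) (fun p => f p * rad p ^ 2)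
/-- integral over Σ_τ with the measure dv′dω (v′ = v on the null part, r in the cylinder) -/
def lIntSig (R τ : ℝ) (f : V → ℝ) : ℝ≥0∞ :=
  if 0 ≤ τ then (∫⁻ r' in Icc (0 : ℝ) R, sphI f τ r') + lIntH ((τ - R) / 2) ((τ + R) / 2) f
  else lIntH ((τ - R) / 2) (-((τ - R) / 2)) f

/-- the starting value v(u) of H_u (t = 0 in the exterior, r = R in the interior) -/
def vStart (R u : ℝ) : ℝ := if u ≤ -R / 2 then -u else 2 * R + u

/-- exterior region in (u,v,ω) coordinates: double null integral ∬_{𝒟_{τ₁}^{τ₂}} f dv dω du -/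
def lIntExtUV (R τ₁ τ₂ : ℝ) (f : V → ℝ) : ℝ≥0∞ :=
  ∫⁻ u in Icc ((τ₂ - R) / 2) ((τ₁ - R) / 2),
    ∫⁻ v in Icc (-u) (-((τ₂ - R) / 2)), sphI f (u + v) (v - u)

/-! ## Energy fluxes -/
def EphiH (A : V → Fin 4 → ℝ) (φ : V → ℂ) (u v0 : ℝ) : ℝ≥0∞ :=
  lIntH u v0 (fun p => (eDL A φ p + eDslash A φ p) * rad p ^ 2)
def EphiHseg (A : V → Fin 4 → ℝ) (φ : V → ℂ) (u v0 v1 : ℝ) : ℝ≥0∞ :=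
  lIntHseg u v0 v1 (fun p => (eDL A φ p + eDslash A φ p) * rad p ^ 2)
def EphiHb (A : V → Fin 4 → ℝ) (φ : V → ℂ) (v u0 u1 : ℝ) : ℝ≥0∞ :=
  lIntHb v u0 u1 (fun p => (eDLb A φ p + eDslash A φ p) * rad p ^ 2)
/-- energy flux E[φ](Σ_τ) -/
def EphiSig (R : ℝ) (A : V → Fin 4 → ℝ) (φ : V → ℂ) (τ : ℝ) : ℝ≥0∞ :=
  if 0 ≤ τ then lIntBall τ R (eD A φ) + EphiH A φ ((τ - R) / 2) ((τ + R) / 2)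
  else EphiH A φ ((τ - R) / 2) (-((τ - R) / 2))

def EfH (G : V → Fin 4 → Fin 4 → ℝ) (u v0 : ℝ) : ℝ≥0∞ :=
  lIntH u v0 (fun p => (rhoC G p ^ 2 + sigmaSq G p + alphaSq G p) * rad p ^ 2)
def EfHseg (G : V → Fin 4 → Fin 4 → ℝ) (u v0 v1 : ℝ) : ℝ≥0∞ :=
  lIntHseg u v0 v1 (fun p => (rhoC G p ^ 2 + sigmaSq G p + alphaSq G p) * rad p ^ 2)
def EfHb (G : V → Fin 4 → Fin 4 → ℝ) (v u0 u1 : ℝ) : ℝ≥0∞ :=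
  lIntHb v u0 u1 (fun p => (rhoC G p ^ 2 + sigmaSq G p + abarSq G p) * rad p ^ 2)
/-- energy flux E[G](Σ_τ) of a 2-form -/
def EfSig (R : ℝ) (G : V → Fin 4 → Fin 4 → ℝ) (τ : ℝ) : ℝ≥0∞ :=
  if 0 ≤ τ then
    lIntBall τ R (fun p => rhoC G p ^ 2 + sigmaSq G p + (1 / 2) * (alphaSq G p + abarSq G p))
      + EfH G ((τ - R) / 2) ((τ + R) / 2)
  else EfH G ((τ - R) / 2) (-((τ - R) / 2))

/-! ## The commutation vector fields Z = {∂_t, Ω_ij} and Lie derivatives -/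
inductive Gen : Type
  | time : Gen
  | rot : Fin 3 → Fin 3 → Gen
  deriving DecidableEq

instance : Fintype Gen := by
  classical
  exact Fintype.ofSurjective
    (fun x : Option (Fin 3 × Fin 3) => (x.casesOn Gen.time (fun ij => Gen.rot ij.1 ij.2) : Gen))
    (by rintro (_ | ⟨i, j⟩); exacts [⟨none, rfl⟩, ⟨some (i, j), rfl⟩])

/-- the vector field of a generator: ∂_t, resp. Ω_ij = x_i ∂_j − x_j ∂_i -/
def genV : Gen → V → V
  | Gen.time, _ => Pi.single 0 1
  | Gen.rot i j, p => fun μ => (if μ = j.succ then p i.succ else 0) - (if μ = i.succ then p j.succ else 0)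

/-- Lie derivative of a 2-form along X -/
def lie2 (X : V → V) (G : V → Fin 4 → Fin 4 → ℝ) (p : V) (μ ν : Fin 4) : ℝ :=
  fderiv ℝ (fun q => G q μ ν) p (X p)
    + ∑ lam, pd μ (fun q => X q lam) p * G p lam ν
    + ∑ lam, pd ν (fun q => X q lam) p * G p μ lam
/-- Lie derivative of a 1-form along X -/
def lie1 (X : V → V) (J : V → Fin 4 → ℝ) (p : V) (μ : Fin 4) : ℝ :=
  fderiv ℝ (fun q => J q μ) p (X p) + ∑ lam, pd μ (fun q => X q lam) p * J p lam

def lie2Iter : List Gen → (V → Fin 4 → Fin 4 → ℝ) → V → Fin 4 → Fin 4 → ℝ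
  | [], G => G
  | g :: w, G => lie2 (genV g) (lie2Iter w G)
def lie1Iter : List Gen → (V → Fin 4 → ℝ) → V → Fin 4 → ℝ
  | [], J => J
  | g :: w, J => lie1 (genV g) (lie1Iter w J)

/-- covariant derivative D_Z along a generator -/
def covDZ (A : V → Fin 4 → ℝ) (g : Gen) (φ : V → ℂ) (p : V) : ℂ := dirD A (genV g p) φ p
def covDZIter (A : V → Fin 4 → ℝ) : List Gen → (V → ℂ) → V → ℂ
  | [], φ => φ
  | g :: w, φ => covDZ A g (covDZIter A w φ)

/-! ## Charge and the chargeless part -/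
def esingle (j : Fin 3) : E3 := EuclideanSpace.single j 1
/-- total charge q₀ = (1/4π) ∫ div E dx computed at t = 0 -/
def charge (G : V → Fin 4 → Fin 4 → ℝ) : ℝ :=
  (1 / (4 * Real.pi)) *
    ∫ x : E3, ∑ i : Fin 3, fderiv ℝ (fun y => G (stp 0 y) 0 i.succ) x (esingle i)
/-- the 2-form dt ∧ dr -/
def dtdr (p : V) (μ ν : Fin 4) : ℝ :=
  (if μ = 0 then 1 else 0) * (if ν = 0 then 0 else p ν / rad p)
    - (if ν = 0 then 1 else 0) * (if μ = 0 then 0 else p μ / rad p)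
/-- the chargeless part F̄ = F − χ_{{r ≥ t+R}} q₀ r^{-2} dt∧dr -/
def Fbar (R q0 : ℝ) (G : V → Fin 4 → Fin 4 → ℝ) (p : V) (μ ν : Fin 4) : ℝ :=
  G p μ ν - (if tC p + R ≤ rad p then q0 / rad p ^ 2 else 0) * dtdr p μ ν

/-! ## The norms m_k, E₀^k, M_k of the Maxwell data and current -/
def twoSqAll (G : V → Fin 4 → Fin 4 → ℝ) (p : V) : ℝ := ∑ μ, ∑ ν, (G p μ ν) ^ 2
/-- |∇J|² (spatial gradient of a 1-form) -/
def grad3Sq1 (J : V → Fin 4 → ℝ) (p : V) : ℝ :=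
  ∑ i : Fin 3, ∑ μ, (pd i.succ (fun q => J q μ) p) ^ 2
def JdensL (J : V → Fin 4 → ℝ) (p : V) : ℝ := (ap1 J (Lv p) p) ^ 2
def JdensLb (J : V → Fin 4 → ℝ) (p : V) : ℝ := (ap1 J (Lbv p) p) ^ 2
def JdensMix (J : V → Fin 4 → ℝ) (p : V) : ℝ :=
  (Real.sqrt (JslashSq J p) + |ap1 J (Lv p) p|) ^ 2

/-- the quantity m_k measuring the current J -/
def mFn (R γ₀ ε : ℝ) (J : V → Fin 4 → ℝ) (q0 : ℝ) (k : ℕ) : ℝ≥0∞ :=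
  (∑ l ∈ Finset.range (k + 1), ∑ w : Fin l → Gen,
      (wI (1 + γ₀) (1 + ε) (JslashSq (lie1Iter (List.ofFn w) J)) (regGe R)
        + wI (2 + γ₀) 0 (JdensL (lie1Iter (List.ofFn w) J)) (regGe R)
        + wI (1 + ε) (1 + γ₀) (JdensMix (lie1Iter (List.ofFn w) J)) halfSpace
        + wI (1 - ε) (1 + γ₀ + 2 * ε) (JdensLb (lie1Iter (List.ofFn w) J)) halfSpace))
  + (∑ l ∈ Finset.range k, ∑ w : Fin l → Gen,
      wI 0 (1 + γ₀) (grad3Sq1 (lie1Iter (List.ofFn w) J)) (regLe (2 * R)))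
  + oR |q0| * ⨆ (τ : ℝ) (_ : τ ≤ 0), oR (taupl τ ^ (1 + γ₀)) *
      ∫⁻ p in Dfrom R τ, oR (|ap1 J (Lbv p) p| / rad p ^ 2)

/-- weighted initial energy E₀^k[G] of a 2-form -/
def E0F (γ₀ : ℝ) (G : V → Fin 4 → Fin 4 → ℝ) (k : ℕ) : ℝ≥0∞ :=
  ∑ l ∈ Finset.range (k + 1), ∑ w : Fin l → Gen,
    lIntE3 (fun x => (1 + ‖x‖) ^ (1 + γ₀) * twoSqAll (lie2Iter (List.ofFn w) G) (stp 0 x))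

/-- M_k = m_k + E₀^k[F̄] + 1 + |q₀| for the Maxwell field G with current δG -/
def MFn (R γ₀ ε : ℝ) (G : V → Fin 4 → Fin 4 → ℝ) (k : ℕ) : ℝ≥0∞ :=
  mFn R γ₀ ε (fun p μ => divSnd G p μ) (charge G) k
    + E0F γ₀ (Fbar R (charge G) G) k + 1 + oR |charge G|

/-! ## The norms E₀^k[φ], 𝓔_k[φ] of the scalar field -/
def E0phi (γ₀ : ℝ) (A : V → Fin 4 → ℝ) (φ : V → ℂ) (k : ℕ) : ℝ≥0∞ :=
  ∑ l ∈ Finset.range (k + 1), ∑ w : Fin l → Gen, ∑ j : Fin 3,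
    lIntE3 (fun x =>
      (1 + ‖x‖) ^ (1 + γ₀) * ‖covDZIter A (List.ofFn w) (covD A j.succ φ) (stp 0 x)‖ ^ 2)

def calE (γ₀ ε : ℝ) (A : V → Fin 4 → ℝ) (φ : V → ℂ) (k : ℕ) : ℝ≥0∞ :=
  E0phi γ₀ A φ k
    + ∑ l ∈ Finset.range (k + 1), ∑ w : Fin l → Gen,
        (wI (1 + γ₀) (1 + ε) (fun p => ‖covDZIter A (List.ofFn w) (boxA A φ) p‖ ^ 2) halfSpace
          + wI (1 + ε) (1 + γ₀) (fun p => ‖covDZIter A (List.ofFn w) (boxA A φ) p‖ ^ 2) halfSpace)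

/-! ## Mixed L_u²L_v^∞L_ω² and L_v²L_u^∞L_ω² norms on 𝒟̄_τ -/
def mixULV (R τ : ℝ) (f : V → ℝ) : ℝ≥0∞ :=
  if 0 ≤ τ then
    ∫⁻ u in Ici ((τ - R) / 2), ⨆ v ∈ Ici (u + R), sphI (fun p => f p ^ 2) (u + v) (v - u)
  else
    ∫⁻ u in Iic ((τ - R) / 2), ⨆ v ∈ Ici (-u), sphI (fun p => f p ^ 2) (u + v) (v - u)
def mixVLU (R τ : ℝ) (f : V → ℝ) : ℝ≥0∞ :=
  if 0 ≤ τ then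
    ∫⁻ v in Ici ((τ + R) / 2),
      ⨆ u ∈ Icc ((τ - R) / 2) (v - R), sphI (fun p => f p ^ 2) (u + v) (v - u)
  else
    ∫⁻ v in Ici (-((τ - R) / 2)),
      ⨆ u ∈ Icc (-v) ((τ - R) / 2), sphI (fun p => f p ^ 2) (u + v) (v - u)

/-! ## Asymptotic vanishing conditions -/
def vanishNullInf (φ : V → ℂ) : Prop :=
  ∀ u : ℝ, ∀ ω : E3, ‖ω‖ = 1 →
    Filter.Tendsto (fun v => φ (pt (u + v) (v - u) ω)) Filter.atTop (nhds 0)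
def vanishSpatialInf (φ : V → ℂ) : Prop :=
  ∀ ω : E3, ‖ω‖ = 1 → Filter.Tendsto (fun r => φ (pt 0 r ω)) Filter.atTop (nhds 0)

/-! ## Structural properties -/
def AntiSym (G : V → Fin 4 → Fin 4 → ℝ) : Prop := ∀ p μ ν, G p μ ν = -G p ν μ
def Bianchi (G : V → Fin 4 → Fin 4 → ℝ) : Prop :=
  ∀ (p : V) (γ' μ ν : Fin 4),
    pd γ' (fun q => G q μ ν) p + pd μ (fun q => G q ν γ') p + pd ν (fun q => G q γ' μ) p = 0
def Smooth2Form (G : V → Fin 4 → Fin 4 → ℝ) : Prop := ∀ μ ν, ContDiff ℝ (⊤ : ℕ∞) (fun p => G p μ ν)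

/-! ## Initial data (for the Cauchy problem) -/
def pd3 (j : Fin 3) (f : E3 → ℝ) (x : E3) : ℝ := fderiv ℝ f x (esingle j)
def pd3C (j : Fin 3) (f : E3 → ℂ) (x : E3) : ℂ := fderiv ℝ f x (esingle j)
/-- rotation Ω_ij acting on a scalar -/
def rotSc (i j : Fin 3) (f : E3 → ℝ) (x : E3) : ℝ := x i * pd3 j f x - x j * pd3 i f x
def rotScC (i j : Fin 3) (f : E3 → ℂ) (x : E3) : ℂ :=
  (x i : ℂ) * pd3C j f x - (x j : ℂ) * pd3C i f x
/-- rotation Ω_ij acting on a vector field (Lie derivative) -/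
def rotVF (i j : Fin 3) (W : E3 → Fin 3 → ℝ) (x : E3) (k : Fin 3) : ℝ :=
  rotSc i j (fun y => W y k) x - ((if k = j then W x i else 0) - (if k = i then W x j else 0))

abbrev Gen3 : Type := Fin 3 × Fin 3

def rotScIter : List Gen3 → (E3 → ℝ) → E3 → ℝ
  | [], f => f
  | g :: w, f => rotSc g.1 g.2 (rotScIter w f)
def rotScCIter : List Gen3 → (E3 → ℂ) → E3 → ℂ
  | [], f => f
  | g :: w, f => rotScC g.1 g.2 (rotScCIter w f)
def rotVFIter : List Gen3 → (E3 → Fin 3 → ℝ) → E3 → Fin 3 → ℝ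
  | [], W => W
  | g :: w, W => rotVF g.1 g.2 (rotVFIter w W)
def pd3Iter : List (Fin 3) → (E3 → ℝ) → E3 → ℝ
  | [], f => f
  | j :: w, f => pd3 j (pd3Iter w f)
def pd3CIter : List (Fin 3) → (E3 → ℂ) → E3 → ℂ
  | [], f => f
  | j :: w, f => pd3C j (pd3CIter w f)
def pd3VFIter (w : List (Fin 3)) (W : E3 → Fin 3 → ℝ) (x : E3) (k : Fin 3) : ℝ :=
  pd3Iter w (fun y => W y k) x

/-- the weighted Sobolev norm 𝓜 of the Maxwell initial data (E^{df}, H) -/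
def calM (γ₀ : ℝ) (Edf Hd : E3 → Fin 3 → ℝ) : ℝ≥0∞ :=
  ∑ l ∈ Finset.range 3,
    ((∑ w : Fin l → Gen3, lIntE3 (fun x => (1 + ‖x‖) ^ (1 + γ₀) *
        ((∑ k : Fin 3, (rotVFIter (List.ofFn w) Edf x k) ^ 2)
          + ∑ k : Fin 3, (rotVFIter (List.ofFn w) Hd x k) ^ 2)))
      + ∑ w : Fin l → Fin 3, lIntE3 (fun x => (1 + ‖x‖) ^ (1 + γ₀) *
        ((∑ k : Fin 3, (pd3VFIter (List.ofFn w) Edf x k) ^ 2)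
          + ∑ k : Fin 3, (pd3VFIter (List.ofFn w) Hd x k) ^ 2)))

/-- the weighted Sobolev norm 𝓔 of the scalar initial data (φ₀, φ₁) -/
def calEdata (γ₀ : ℝ) (φ₀ φ₁ : E3 → ℂ) : ℝ≥0∞ :=
  ∑ l ∈ Finset.range 3,
    ((∑ w : Fin l → Gen3, lIntE3 (fun x => (1 + ‖x‖) ^ (1 + γ₀) *
        ((∑ j : Fin 3, ‖pd3C j (rotScCIter (List.ofFn w) φ₀) x‖ ^ 2)
          + ‖rotScCIter (List.ofFn w) φ₁ x‖ ^ 2)))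
      + (∑ w : Fin (l + 1) → Fin 3,
          lIntE3 (fun x => (1 + ‖x‖) ^ (1 + γ₀) * ‖pd3CIter (List.ofFn w) φ₀ x‖ ^ 2))
      + (∑ w : Fin l → Fin 3,
          lIntE3 (fun x => (1 + ‖x‖) ^ (1 + γ₀) * ‖pd3CIter (List.ofFn w) φ₁ x‖ ^ 2))
      + lIntE3 (fun x => (1 + ‖x‖) ^ (1 + γ₀) * ‖φ₀ x‖ ^ 2))

/-- the Maxwell–Klein–Gordon equations (for t ≥ 0) -/
def IsMKG (A : V → Fin 4 → ℝ) (φ : V → ℂ) : Prop :=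
  ∀ p : V, 0 ≤ tC p →
    (∀ μ, divSnd (curv A) p μ = Jsf A φ p μ) ∧ boxA A φ p = 0

/-- the solution attains the initial data (E, H, φ₀, φ₁) -/
def InitData (A : V → Fin 4 → ℝ) (φ : V → ℂ) (Ed Hd : E3 → Fin 3 → ℝ)
    (φ₀ φ₁ : E3 → ℂ) : Prop :=
  (∀ (x : E3) (i : Fin 3), curv A (stp 0 x) 0 i.succ = Ed x i)
    ∧ (∀ x : E3, curv A (stp 0 x) 2 3 = Hd x 0 ∧ curv A (stp 0 x) 3 1 = Hd x 1
        ∧ curv A (stp 0 x) 1 2 = Hd x 2)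
    ∧ (∀ x : E3, φ (stp 0 x) = φ₀ x) ∧ (∀ x : E3, covD A 0 φ (stp 0 x) = φ₁ x)

/-- the compatibility (constraint) conditions -/
def Admissible (Ed Hd : E3 → Fin 3 → ℝ) (φ₀ φ₁ : E3 → ℂ) : Prop :=
  (∀ x : E3, (∑ i : Fin 3, pd3 i (fun y => Ed y i) x) = (φ₀ x * (starRingEnd ℂ) (φ₁ x)).im)
    ∧ (∀ x : E3, (∑ i : Fin 3, pd3 i (fun y => Hd y i) x) = 0)

end MKG

namespace MKG
open scoped Pointwise NNReal

theorem norm_normalize_sub_normalize_le {F : Type*} [NormedAddCommGroup F] [NormedSpace ℝ F]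
    {a b : F} (ha : 1 ≤ ‖a‖) (hb : 1 ≤ ‖b‖) :
    ‖‖a‖⁻¹ • a - ‖b‖⁻¹ • b‖ ≤ 2 * ‖a - b‖ := by
  have ha0 : 0 < ‖a‖ := by linarith
  have hb0 : 0 < ‖b‖ := by linarith
  have hsplit : ‖a‖⁻¹ • a - ‖b‖⁻¹ • b = ‖a‖⁻¹ • (a - b) + (‖a‖⁻¹ - ‖b‖⁻¹) • b := by
    rw [smul_sub, sub_smul]; abel
  have hinv : ‖a‖⁻¹ ≤ 1 := inv_le_one_of_one_le₀ ha
  have h1 : ‖‖a‖⁻¹ • (a - b)‖ ≤ ‖a - b‖ := by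
    rw [norm_smul, norm_inv, norm_norm]
    exact mul_le_of_le_one_left (norm_nonneg _) hinv
  have h2 : ‖(‖a‖⁻¹ - ‖b‖⁻¹) • b‖ ≤ ‖a - b‖ := by
    have : (‖a‖⁻¹ - ‖b‖⁻¹) * ‖b‖ = ‖a‖⁻¹ * (‖b‖ - ‖a‖) := by field_simp
    rw [norm_smul, Real.norm_eq_abs, ← abs_of_pos hb0, ← abs_mul, abs_of_pos hb0, this, abs_mul,
      abs_of_pos (inv_pos.2 ha0), abs_sub_comm]
    exact (mul_le_of_le_one_left (abs_nonneg _) hinv).trans (abs_norm_sub_norm_le a b)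
  rw [hsplit]
  linarith [norm_add_le (‖a‖⁻¹ • (a - b)) ((‖a‖⁻¹ - ‖b‖⁻¹) • b)]

/-- The face of the cube with normal direction `i`, at signed distance `e` from the origin. -/
def cubeFace (i : Fin 3) (e : ℝ) (y : Fin 2 → ℝ) : E3 := WithLp.toLp 2 (i.insertNth e y)

theorem cubeFace_apply_same (i : Fin 3) (e : ℝ) (y : Fin 2 → ℝ) : cubeFace i e y i = e := by
  simp [cubeFace]

theorem cubeFace_apply_succAbove (i : Fin 3) (e : ℝ) (y : Fin 2 → ℝ) (j : Fin 2) :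
    cubeFace i e y (i.succAbove j) = y j := by
  simp [cubeFace]

/-- The central projection of a face of the cube to the unit sphere. -/
def faceProj (i : Fin 3) (e : ℝ) (y : Fin 2 → ℝ) : E3 :=
  ‖cubeFace i e y‖⁻¹ • cubeFace i e y

theorem one_le_norm_cubeFace {e : ℝ} (he : |e| = 1) (i : Fin 3) (y : Fin 2 → ℝ) :
    1 ≤ ‖cubeFace i e y‖ := by
  have := PiLp.norm_apply_le (cubeFace i e y) i
  rwa [cubeFace_apply_same, Real.norm_eq_abs, he] at this

theorem exists_lipschitzWith_faceProj {e : ℝ} (he : |e| = 1) (i : Fin 3) :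
    ∃ K : ℝ≥0, LipschitzWith K (faceProj i e) := by
  obtain ⟨K, hK⟩ : ∃ K : ℝ≥0, LipschitzWith K (WithLp.toLp 2 : (Fin 3 → ℝ) → E3) :=
    ⟨_, PiLp.lipschitzWith_toLp 2 _⟩
  refine ⟨2 * K, LipschitzWith.of_dist_le_mul fun y z => ?_⟩
  have hins : dist (i.insertNth e y : Fin 3 → ℝ) (i.insertNth e z) ≤ dist y z := by
    refine (dist_pi_le_iff dist_nonneg).2 fun j => ?_
    refine Fin.succAboveCases i ?_ (fun k => ?_) j
    · simp
    · simpa using dist_le_pi_dist y z k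
  have h1 := norm_normalize_sub_normalize_le (one_le_norm_cubeFace he i y)
    (one_le_norm_cubeFace he i z)
  have h2 := hK.dist_le_mul (i.insertNth e y) (i.insertNth e z)
  rw [dist_eq_norm]
  calc _ ≤ 2 * ‖cubeFace i e y - cubeFace i e z‖ := h1
    _ ≤ 2 * (K * dist (i.insertNth e y : Fin 3 → ℝ) (i.insertNth e z)) := by
        rw [← dist_eq_norm]; gcongr; exact h2
    _ ≤ 2 * (K * dist y z) := by gcongr
    _ = _ := by push_cast; ring

theorem volume_setOf_scaled_mem {e : ℝ} (he : |e| = 1) {T : Set (Fin 2 → ℝ)}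
    (hT : MeasurableSet T) (i : Fin 3) :
    volume T ≤ 64 * volume {x : E3 | e * x i ∈ Ioo (1 / 4 : ℝ) (1 / 2) ∧
      (e * x i)⁻¹ • (fun j => x (i.succAbove j)) ∈ T} := by
  have hmp := (volume_preserving_piFinSuccAbove (fun _ : Fin 3 => ℝ) i).comp
    (PiLp.volume_preserving_ofLp (Fin 3))
  set Q : Set (ℝ × (Fin 2 → ℝ)) :=
    {q | e * q.1 ∈ Ioo (1 / 4 : ℝ) (1 / 2) ∧ (e * q.1)⁻¹ • q.2 ∈ T} with hQ
  have hI : MeasurableSet {h : ℝ | e * h ∈ Ioo (1 / 4 : ℝ) (1 / 2)} :=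
    measurableSet_Ioo.preimage (by fun_prop)
  have hQm : MeasurableSet Q := by
    refine MeasurableSet.inter (hI.preimage measurable_fst) (hT.preimage ?_)
    fun_prop
  have hpre := hmp.measure_preimage hQm.nullMeasurableSet
  have hset : {x : E3 | e * x i ∈ Ioo (1 / 4 : ℝ) (1 / 2) ∧
      (e * x i)⁻¹ • (fun j => x (i.succAbove j)) ∈ T} =
      (MeasurableEquiv.piFinSuccAbove (fun _ : Fin 3 => ℝ) i ∘ WithLp.ofLp) ⁻¹' Q := rfl
  have hvolI : volume {h : ℝ | e * h ∈ Ioo (1 / 4 : ℝ) (1 / 2)} = ENNReal.ofReal (1 / 4) := by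
    have he0 : e ≠ 0 := by rintro rfl; simp at he
    have := Real.volume_preimage_mul_left he0 (Ioo (1 / 4 : ℝ) (1 / 2))
    rw [abs_inv, he] at this
    have h2 : volume (Ioo (1 / 4 : ℝ) (1 / 2)) = ENNReal.ofReal (1 / 4) := by
      rw [Real.volume_Ioo]; norm_num
    rw [h2] at this
    exact this.trans (by simp)
  rw [hset, hpre, Measure.volume_eq_prod, Measure.prod_apply hQm]
  have key : ∫⁻ h in {h : ℝ | e * h ∈ Ioo (1 / 4 : ℝ) (1 / 2)}, ENNReal.ofReal (1 / 16) * volume T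
      ≤ ∫⁻ h, volume (Prod.mk h ⁻¹' Q) := by
    rw [← lintegral_indicator hI]
    refine lintegral_mono fun h => ?_
    by_cases hh : h ∈ {h : ℝ | e * h ∈ Ioo (1 / 4 : ℝ) (1 / 2)}
    · rw [indicator_of_mem hh]
      have hh' : e * h ∈ Ioo (1 / 4 : ℝ) (1 / 2) := hh
      have hpos : 0 < e * h := by linarith [hh'.1]
      have : Prod.mk h ⁻¹' Q = ((e * h)⁻¹ • ·) ⁻¹' T := by
        ext y; simp only [hQ, mem_preimage, mem_ofPred_eq, hh', true_and]
      rw [this, Measure.addHaar_preimage_smul _ (inv_ne_zero hpos.ne')]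
      gcongr
      rw [abs_of_pos (by positivity)]
      simp only [Module.finrank_fintype_fun_eq_card, Fintype.card_fin, inv_pow, inv_inv]
      nlinarith [hh'.1]
    · rw [indicator_of_notMem hh]; exact zero_le
  rw [lintegral_const, Measure.restrict_apply_univ, hvolI] at key
  calc volume T = 64 * (ENNReal.ofReal (1 / 16) * volume T * ENNReal.ofReal (1 / 4)) := by
        rw [mul_right_comm, ← ENNReal.ofReal_mul (by norm_num), ← mul_assoc,
          show (64 : ℝ≥0∞) = ENNReal.ofReal 64 by simp, ← ENNReal.ofReal_mul (by norm_num)]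
        norm_num
    _ ≤ _ := by gcongr

theorem exists_hausdorffMeasure_le_volume_cone_of_face {e : ℝ} (he : |e| = 1) (i : Fin 3) :
    ∃ K : ℝ≥0, ∀ S : Set E3, MeasurableSet S → S ⊆ sphere 0 1 → (∀ ω ∈ S, 1 / 2 ≤ e * ω i) →
      μH[2] S ≤ K * volume (Ioo (0 : ℝ) 1 • S) := by
  obtain ⟨K, hK⟩ := exists_lipschitzWith_faceProj he i
  have hee : e * e = 1 := by rw [← abs_mul_abs_self, he]; norm_num
  refine ⟨K ^ 2 * 64, fun S hS hS1 hSe => ?_⟩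
  have hT : MeasurableSet (faceProj i e ⁻¹' S) := hS.preimage hK.continuous.measurable
  have hface : ∀ (h : ℝ) (x : E3), h = e * x i → h ≠ 0 →
      x = h • cubeFace i e (h⁻¹ • fun j => x (i.succAbove j)) := by
    intro h x hx h0
    ext j
    refine Fin.succAboveCases i ?_ (fun k => ?_) j
    · rw [PiLp.smul_apply, cubeFace_apply_same, hx, smul_eq_mul]; linear_combination -x i * hee
    · rw [PiLp.smul_apply, cubeFace_apply_succAbove]; simp [h0]
  have hsub : S ⊆ faceProj i e '' (faceProj i e ⁻¹' S) := by
    intro ω hω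
    have hpos : 0 < e * ω i := by linarith [hSe ω hω]
    have h1 := hface _ ω rfl hpos.ne'
    have hn : ‖ω‖ = 1 := by simpa using hS1 hω
    set w := cubeFace i e ((e * ω i)⁻¹ • fun j => ω (i.succAbove j)) with hw
    have hp : faceProj i e ((e * ω i)⁻¹ • fun j => ω (i.succAbove j)) = ω := by
      rw [h1, norm_smul, Real.norm_of_nonneg hpos.le] at hn
      rw [faceProj, ← hw, ← eq_inv_of_mul_eq_one_left hn, ← h1]
    exact ⟨_, by rwa [mem_preimage, hp], hp⟩
  have hcone : {x : E3 | e * x i ∈ Ioo (1 / 4 : ℝ) (1 / 2) ∧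
      (e * x i)⁻¹ • (fun j => x (i.succAbove j)) ∈ faceProj i e ⁻¹' S} ⊆ Ioo (0 : ℝ) 1 • S := by
    rintro x ⟨hx, hxT⟩
    have hpos : 0 < e * x i := by linarith [hx.1]
    have h1 := hface _ x rfl hpos.ne'
    rw [mem_preimage, faceProj] at hxT
    set w := cubeFace i e ((e * x i)⁻¹ • fun j => x (i.succAbove j)) with hw
    have hwn : 1 ≤ ‖w‖ := one_le_norm_cubeFace he i _
    have hwi : w i = e := cubeFace_apply_same _ _ _
    have hle := hSe _ hxT
    rw [PiLp.smul_apply, hwi, smul_eq_mul, mul_left_comm, hee, mul_one] at hle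
    have hw2 : ‖w‖ ≤ 2 := by
      have := mul_le_mul_of_nonneg_left hle (norm_nonneg w)
      rw [mul_inv_cancel₀ (by linarith)] at this
      linarith
    refine ⟨e * x i * ‖w‖, ⟨by positivity, by nlinarith [hx.2]⟩, _, hxT, ?_⟩
    simp only
    rw [smul_smul, mul_assoc, mul_inv_cancel₀ (by linarith), mul_one, ← h1]
  calc μH[2] S ≤ μH[2] (faceProj i e '' (faceProj i e ⁻¹' S)) := measure_mono hsub
    _ ≤ (K : ℝ≥0∞) ^ (2 : ℝ) * μH[2] (faceProj i e ⁻¹' S) :=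
        hK.hausdorffMeasure_image_le (by norm_num) _
    _ = (K : ℝ≥0∞) ^ 2 * volume (faceProj i e ⁻¹' S) := by
        rw [← hausdorffMeasure_pi_real]; simp
    _ ≤ (K : ℝ≥0∞) ^ 2 * (64 * volume (Ioo (0 : ℝ) 1 • S)) := by
        gcongr
        exact (volume_setOf_scaled_mem he hT i).trans (by gcongr)
    _ = _ := by push_cast; ring

theorem exists_hausdorffMeasure_le_volume_cone :
    ∃ K : ℝ≥0, ∀ S : Set E3, MeasurableSet S → S ⊆ sphere 0 1 →
      μH[2] S ≤ K * volume (Ioo (0 : ℝ) 1 • S) := by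
  have hsgn : ∀ b : Bool, |(if b then 1 else -1 : ℝ)| = 1 := by rintro (_ | _) <;> simp
  choose K hK using fun p : Fin 3 × Bool =>
    exists_hausdorffMeasure_le_volume_cone_of_face (hsgn p.2) p.1
  refine ⟨∑ p, K p, fun S hS hS1 => ?_⟩
  let P : Fin 3 × Bool → Set E3 := fun p => S ∩ {ω | 1 / 2 ≤ (if p.2 then 1 else -1 : ℝ) * ω p.1}
  have hcov : S ⊆ ⋃ p, P p := by
    intro ω hω
    have hn : ‖ω‖ ^ 2 = 1 := by rw [show ‖ω‖ = 1 by simpa using hS1 hω]; norm_num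
    rw [EuclideanSpace.norm_sq_eq, Fin.sum_univ_three] at hn
    simp only [Real.norm_eq_abs, sq_abs] at hn
    by_contra hcon
    have hlt : ∀ i, ω i ^ 2 < 1 / 4 := by
      intro i
      have h1 : ω i < 1 / 2 := by
        by_contra! h
        exact hcon (mem_iUnion.2 ⟨(i, true), hω, by simpa using h⟩)
      have h2 : -ω i < 1 / 2 := by
        by_contra! h
        exact hcon (mem_iUnion.2 ⟨(i, false), hω, by simpa using h⟩)
      nlinarith
    linarith [hlt 0, hlt 1, hlt 2]
  have hPm : ∀ p, MeasurableSet (P p) := fun p =>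
    hS.inter (measurableSet_le measurable_const (by fun_prop))
  calc μH[2] S ≤ ∑ p, μH[2] (P p) :=
        (measure_mono hcov).trans (measure_iUnion_fintype_le _ _)
    _ ≤ ∑ p, (K p : ℝ≥0∞) * volume (Ioo (0 : ℝ) 1 • S) := by
        refine Finset.sum_le_sum fun p _ => ?_
        refine (hK p _ (hPm p) (inter_subset_left.trans hS1) fun ω hω => hω.2).trans ?_
        gcongr
        exact inter_subset_left
    _ = _ := by rw [← Finset.sum_mul]; push_cast; rfl

instance isFiniteMeasure_hausdorffMeasure_sphere :
    IsFiniteMeasure ((μH[2] : Measure E3).restrict (sphere 0 1)) := by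
  obtain ⟨K, hK⟩ := exists_hausdorffMeasure_le_volume_cone
  refine ⟨?_⟩
  rw [Measure.restrict_apply_univ]
  refine (hK _ isClosed_sphere.measurableSet subset_rfl).trans_lt
    (ENNReal.mul_lt_top coe_lt_top ?_)
  refine (measure_mono ?_).trans_lt (measure_closedBall_lt_top (x := (0 : E3)) (r := 1))
  rintro _ ⟨r, hr, ω, hω, rfl⟩
  have hω1 : ‖ω‖ = 1 := by simpa using hω
  simpa [norm_smul, hω1, abs_of_pos hr.1] using hr.2.le

theorem exists_hausdorffMeasure_comap_le_toSphere :
    ∃ K : ℝ≥0, (μH[2] : Measure E3).comap ((↑) : sphere (0 : E3) 1 → E3) ≤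
      K • (volume : Measure E3).toSphere := by
  obtain ⟨K, hK⟩ := exists_hausdorffMeasure_le_volume_cone
  refine ⟨K, Measure.le_iff.2 fun s hs => ?_⟩
  have hemb : MeasurableEmbedding ((↑) : sphere (0 : E3) 1 → E3) :=
    MeasurableEmbedding.subtype_coe isClosed_sphere.measurableSet
  rw [hemb.comap_apply, Measure.smul_apply, Measure.toSphere_apply' _ hs]
  refine (hK _ (hemb.measurableSet_image.2 hs) (by rintro _ ⟨x, -, rfl⟩; exact x.2)).trans ?_
  rw [ENNReal.smul_def, smul_eq_mul]
  gcongr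
  refine le_mul_of_one_le_left' ?_
  simp

theorem lintegral_eq_lintegral_toSphere {f : E3 → ℝ≥0∞} (hf : Measurable f) :
    ∫⁻ x, f x = ∫⁻ r in Ioi (0 : ℝ), ENNReal.ofReal (r ^ 2) *
      ∫⁻ ω, f (r • (ω : E3)) ∂(volume : Measure E3).toSphere := by
  have hmp := (volume : Measure E3).measurePreserving_homeomorphUnitSphereProd
  have hd : Module.finrank ℝ E3 - 1 = 2 := by simp
  rw [hd] at hmp
  have hF : Measurable fun p : sphere (0 : E3) 1 × Ioi (0 : ℝ) => f ((p.2 : ℝ) • (p.1 : E3)) :=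
    hf.comp (by fun_prop)
  calc ∫⁻ x, f x = ∫⁻ x in ({0}ᶜ : Set E3), f x := by rw [restrict_compl_singleton]
    _ = ∫⁻ x : ({0}ᶜ : Set E3), f x ∂(volume.comap Subtype.val) :=
        (lintegral_subtype_comap (measurableSet_singleton _).compl _).symm
    _ = ∫⁻ p, f ((p.2 : ℝ) • (p.1 : E3)) ∂((volume : Measure E3).toSphere.prod
          (Measure.volumeIoiPow 2)) := by
        rw [← hmp.lintegral_comp hF]
        refine lintegral_congr fun x => ?_
        congr 1
        simp [homeomorphUnitSphereProd, smul_smul, mul_inv_cancel₀ (norm_ne_zero_iff.2 x.2)]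
    _ = ∫⁻ r, ∫⁻ ω, f ((r : ℝ) • (ω : E3)) ∂(volume : Measure E3).toSphere
          ∂(Measure.volumeIoiPow 2) := lintegral_prod_symm _ hF.aemeasurable
    _ = _ := by
        rw [Measure.volumeIoiPow, lintegral_withDensity_eq_lintegral_mul _ (by fun_prop)
          hF.lintegral_prod_left',
          ← lintegral_subtype_comap measurableSet_Ioi]
        rfl

theorem exists_lintegral_sphere_le_lintegral_closedBall :
    ∃ K : ℝ≥0, ∀ (R : ℝ) (f : E3 → ℝ≥0∞), Measurable f →
      ∫⁻ r in Icc 0 R, ENNReal.ofReal (r ^ 2) * sphLInt (fun ω => f (r • ω)) ≤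
        K * ∫⁻ x in closedBall 0 R, f x := by
  obtain ⟨K, hK⟩ := exists_hausdorffMeasure_comap_le_toSphere
  refine ⟨K, fun R f hf => ?_⟩
  have hB : MeasurableSet (closedBall (0 : E3) R) := isClosed_closedBall.measurableSet
  have hS : MeasurableSet (sphere (0 : E3) 1) := isClosed_sphere.measurableSet
  set g := (closedBall (0 : E3) R).indicator f with hg
  have hgm : Measurable g := hf.indicator hB
  rw [← lintegral_indicator hB, ← hg, lintegral_eq_lintegral_toSphere hgm]
  have hI : (volume.restrict (Icc 0 R) : Measure ℝ) = volume.restrict (Ioc 0 R) :=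
    (Measure.restrict_congr_set Ioc_ae_eq_Icc).symm
  have hle : ∀ r ∈ Ioc 0 R, sphLInt (fun ω => f (r • ω)) ≤
      K * ∫⁻ ω, g (r • (ω : E3)) ∂(volume : Measure E3).toSphere := by
    intro r hr
    rw [sphLInt, ← lintegral_subtype_comap hS]
    refine (lintegral_mono' hK le_rfl).trans ?_
    rw [lintegral_smul_measure, ENNReal.smul_def, smul_eq_mul]
    gcongr with ω
    refine (indicator_of_mem ?_ f).ge
    have hω1 : ‖(ω : E3)‖ = 1 := by simp
    simpa [norm_smul, abs_of_pos hr.1] using hr.2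
  calc _ = ∫⁻ r in Ioc 0 R, ENNReal.ofReal (r ^ 2) * sphLInt (fun ω => f (r • ω)) := by rw [hI]
    _ ≤ ∫⁻ r in Ioc 0 R, K * (ENNReal.ofReal (r ^ 2) *
          ∫⁻ ω, g (r • (ω : E3)) ∂(volume : Measure E3).toSphere) := by
        refine setLIntegral_mono' measurableSet_Ioc fun r hr => ?_
        rw [mul_left_comm]
        gcongr
        exact hle r hr
    _ ≤ ∫⁻ r in Ioi 0, K * (ENNReal.ofReal (r ^ 2) *
          ∫⁻ ω, g (r • (ω : E3)) ∂(volume : Measure E3).toSphere) :=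
        lintegral_mono_set Ioc_subset_Ioi_self
    _ = _ := lintegral_const_mul' _ _ coe_ne_top

theorem lintegral_Ici_le_of_forall_lintegral_Icc_le {f : ℝ → ℝ≥0∞} {a : ℝ} {M : ℝ≥0∞}
    (h : ∀ b, a ≤ b → ∫⁻ r in Icc a b, f r ≤ M) : ∫⁻ r in Ici a, f r ≤ M := by
  have hU : Ici a = ⋃ n : ℕ, Icc a (a + n) := by
    ext x
    simp only [mem_Ici, mem_iUnion, mem_Icc]
    refine ⟨fun hx => ?_, fun ⟨_, hx, _⟩ => hx⟩
    obtain ⟨n, hn⟩ := exists_nat_ge (x - a)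
    exact ⟨n, hx, by linarith⟩
  have hd : Directed (· ⊆ ·) fun n : ℕ => Icc a (a + n) :=
    Monotone.directed_le fun m n hmn => Icc_subset_Icc_right (by gcongr)
  rw [hU, setLIntegral_iUnion_of_directed f hd]
  exact iSup_le fun n => h _ (by simp)

theorem integral_add_le_of_le_add_deriv {a b : ℝ} {p q G G' : ℝ → ℝ} (hab : a ≤ b)
    (hG : ContinuousOn G (Icc a b)) (hG' : ∀ r ∈ Ioo a b, HasDerivAt G (G' r) r)
    (hp : ContinuousOn p (Icc a b)) (hq : Measurable q) (hq0 : ∀ r, 0 ≤ q r)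
    (hqfin : ∫⁻ r in Icc a b, ENNReal.ofReal (q r) ≠ ∞)
    (hle : ∀ r ∈ Ioo a b, p r ≤ q r + G' r) :
    (∫ r in Icc a b, p r) + G a ≤ (∫⁻ r in Icc a b, ENNReal.ofReal (q r)).toReal + G b := by
  have hqi : IntegrableOn q (Icc a b) :=
    ⟨hq.aestronglyMeasurable, (hasFiniteIntegral_iff_ofReal (ae_of_all _ hq0)).2 hqfin.lt_top⟩
  have hpi : IntegrableOn p (Icc a b) := hp.integrableOn_Icc
  have h := intervalIntegral.sub_le_integral_of_hasDeriv_right_of_le (g := fun r => -G r)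
    (g' := fun r => -G' r) (φ := fun r => q r - p r) hab hG.fun_neg
    (fun r hr => (hG' r hr).neg.hasDerivWithinAt) (hqi.sub hpi)
    (fun r hr => by linarith [hle r hr])
  rw [intervalIntegral.integral_of_le hab, ← integral_Icc_eq_integral_Ioc,
    integral_sub hqi hpi] at h
  rw [← integral_eq_lintegral_of_nonneg_ae (ae_of_all _ hq0) hq.aestronglyMeasurable]
  linarith

theorem lintegral_le_of_le_add_deriv {a b : ℝ} {p q G G' : ℝ → ℝ} (hab : a ≤ b)
    (hG : ContinuousOn G (Icc a b)) (hG' : ∀ r ∈ Ioo a b, HasDerivAt G (G' r) r)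
    (hp : ContinuousOn p (Icc a b)) (hp0 : ∀ r ∈ Icc a b, 0 ≤ p r)
    (hq : Measurable q) (hq0 : ∀ r, 0 ≤ q r) (hle : ∀ r ∈ Ioo a b, p r ≤ q r + G' r) :
    ∫⁻ r in Icc a b, ENNReal.ofReal (p r) ≤
      (∫⁻ r in Icc a b, ENNReal.ofReal (q r)) + ENNReal.ofReal (G b - G a) := by
  by_cases hfin : ∫⁻ r in Icc a b, ENNReal.ofReal (q r) = ∞
  · simp [hfin]
  have h := integral_add_le_of_le_add_deriv hab hG hG' hp hq hq0 hfin hle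
  rw [← ofReal_integral_eq_lintegral_ofReal hp.integrableOn_Icc
    ((ae_restrict_iff' measurableSet_Icc).2 (ae_of_all _ hp0)), ← ENNReal.ofReal_toReal hfin]
  exact (ENNReal.ofReal_le_ofReal (by linarith)).trans ENNReal.ofReal_add_le

section Hardy
variable {F F' : ℝ → ℂ} {a b γ : ℝ}

theorem abs_inner_le (z w : ℂ) : |inner ℝ z w| ≤ ‖z‖ * ‖w‖ := abs_real_inner_le_norm z w

theorem lintegral_Icc_norm_sq_le (ha : 0 ≤ a) (hab : a ≤ b) (hF : ContinuousOn F (Icc a b))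
    (hd : ∀ r ∈ Ioo a b, HasDerivAt F (F' r) r) (hF' : Measurable F') :
    ∫⁻ r in Icc a b, ENNReal.ofReal (‖F r‖ ^ 2) ≤
      4 * (∫⁻ r in Icc a b, ENNReal.ofReal (r ^ 2 * ‖F' r‖ ^ 2)) +
        2 * ENNReal.ofReal (b * ‖F b‖ ^ 2) := by
  have hq : Measurable fun r => 4 * (r ^ 2 * ‖F' r‖ ^ 2) := by fun_prop
  have h := lintegral_le_of_le_add_deriv (p := fun r => ‖F r‖ ^ 2)
    (q := fun r => 4 * (r ^ 2 * ‖F' r‖ ^ 2)) (G := fun r => 2 * (r * ‖F r‖ ^ 2))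
    (G' := fun r => 2 * (1 * ‖F r‖ ^ 2 + r * (2 * inner ℝ (F r) (F' r)))) hab
    (by fun_prop) (fun r hr => (((hasDerivAt_id r).mul (hd r hr).norm_sq).const_mul 2))
    (by fun_prop) (fun r _ => by positivity) hq (fun r => by positivity) fun r hr => ?_
  · refine h.trans ?_
    simp_rw [ENNReal.ofReal_mul (p := 4) (by norm_num)]
    rw [lintegral_const_mul _ (by fun_prop), ENNReal.ofReal_ofNat]
    gcongr
    rw [← ENNReal.ofReal_ofNat 2, ← ENNReal.ofReal_mul (by norm_num)]
    refine ENNReal.ofReal_le_ofReal (sub_le_self _ (by positivity))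
  · have hr0 : 0 ≤ r := ha.trans hr.1.le
    have h1 := mul_le_mul_of_nonneg_left (neg_le_of_abs_le (abs_inner_le (F r) (F' r))) hr0
    nlinarith [sq_nonneg (‖F r‖ - 2 * (r * ‖F' r‖))]

theorem mul_norm_sq_le_lintegral_Ici (hb : 0 < b) (hF : ContinuousOn F (Ici b))
    (hd : ∀ r ∈ Ioi b, HasDerivAt F (F' r) r) (hF' : Measurable F')
    (hlim : Filter.Tendsto F Filter.atTop (nhds 0)) :
    ENNReal.ofReal (b * ‖F b‖ ^ 2) ≤
      ∫⁻ r in Ici b, ENNReal.ofReal (r ^ 2 * ‖F' r‖ ^ 2) := by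
  set I := ∫⁻ r in Ici b, ENNReal.ofReal (r ^ 2 * ‖F' r‖ ^ 2) with hI
  by_cases hfin : I = ∞
  · simp [hfin]
  refine ENNReal.ofReal_le_of_le_toReal ?_
  have hq : Measurable fun r => r ^ 2 * ‖F' r‖ ^ 2 := by fun_prop
  have hle : ∀ c, b ≤ c → b * ‖F b‖ ^ 2 ≤ I.toReal + 2 * b * inner ℝ (F b) (F c) := by
    intro c hc
    have hIc : ∫⁻ r in Icc b c, ENNReal.ofReal (r ^ 2 * ‖F' r‖ ^ 2) ≤ I :=
      lintegral_mono_set Icc_subset_Ici_self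
    have hFc : ContinuousOn F (Icc b c) := hF.mono Icc_subset_Ici_self
    have hinv : ContinuousOn (fun r : ℝ => r⁻¹) (Icc b c) :=
      continuousOn_inv₀.mono fun r hr => (hb.trans_le hr.1).ne'
    have h := integral_add_le_of_le_add_deriv (p := fun _ => 0)
      (q := fun r => r ^ 2 * ‖F' r‖ ^ 2)
      (G := fun r => 2 * b * inner ℝ (F b) (F r) - ‖F b‖ ^ 2 * b ^ 2 * r⁻¹)
      (G' := fun r => 2 * b * inner ℝ (F b) (F' r) - ‖F b‖ ^ 2 * b ^ 2 * (-(r ^ 2)⁻¹)) hc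
      (by fun_prop)
      (fun r hr => by
        have h0 : r ≠ 0 := (hb.trans hr.1).ne'
        have h1 : HasDerivAt (fun s => inner ℝ (F b) (F s)) (inner ℝ (F b) (F' r)) r := by
          simpa using (hasDerivAt_const r (F b)).inner ℝ (hd r hr.1)
        exact (h1.const_mul _).sub ((hasDerivAt_inv h0).const_mul _))
      continuousOn_const hq (fun r => by positivity) (ne_top_of_le_ne_top hfin hIc) fun r hr => ?_
    · have hmono := ENNReal.toReal_mono hfin hIc
      have hc0 : 0 ≤ ‖F b‖ ^ 2 * b ^ 2 * c⁻¹ := by have := hb.trans_le hc; positivity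
      have hbb : ‖F b‖ ^ 2 * b ^ 2 * b⁻¹ = b * ‖F b‖ ^ 2 := by field_simp
      simp only [integral_zero, real_inner_self_eq_norm_sq, hbb] at h
      linarith
    · have hr0 : 0 < r := hb.trans hr.1
      have h1 := mul_le_mul_of_nonneg_left (neg_le_of_abs_le (abs_inner_le (F b) (F' r))) hb.le
      have h2 := sq_nonneg (r * ‖F' r‖ - ‖F b‖ * b * r⁻¹)
      have h3 : (r * ‖F' r‖ - ‖F b‖ * b * r⁻¹) ^ 2 =
          r ^ 2 * ‖F' r‖ ^ 2 - 2 * (b * (‖F b‖ * ‖F' r‖)) + ‖F b‖ ^ 2 * b ^ 2 * (r ^ 2)⁻¹ := by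
        field_simp
        ring
      linarith
  have hlim2 : Filter.Tendsto (fun c => I.toReal + 2 * b * inner ℝ (F b) (F c)) Filter.atTop
      (nhds (I.toReal + 2 * b * inner ℝ (F b) 0)) :=
    ((tendsto_const_nhds.inner hlim).const_mul _).const_add _
  rw [inner_zero_right, mul_zero, add_zero] at hlim2
  exact ge_of_tendsto hlim2 ((Filter.eventually_ge_atTop b).mono hle)

theorem lintegral_Ici_norm_sq_le (ha : 0 < a) (hF : ContinuousOn F (Ici a))
    (hd : ∀ r ∈ Ioi a, HasDerivAt F (F' r) r) (hF' : Measurable F')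
    (hlim : Filter.Tendsto F Filter.atTop (nhds 0)) :
    ∫⁻ r in Ici a, ENNReal.ofReal (‖F r‖ ^ 2) ≤
      6 * ∫⁻ r in Ici a, ENNReal.ofReal (r ^ 2 * ‖F' r‖ ^ 2) := by
  refine lintegral_Ici_le_of_forall_lintegral_Icc_le fun b hab => ?_
  have h1 := lintegral_Icc_norm_sq_le ha.le hab (hF.mono Icc_subset_Ici_self)
    (fun r hr => hd r hr.1) hF'
  have h2 := mul_norm_sq_le_lintegral_Ici (ha.trans_le hab) (hF.mono (Ici_subset_Ici.2 hab))
    (fun r hr => hd r (hab.trans_lt hr)) hF' hlim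
  calc _ ≤ _ := h1
    _ ≤ 4 * (∫⁻ r in Ici a, ENNReal.ofReal (r ^ 2 * ‖F' r‖ ^ 2)) +
        2 * ∫⁻ r in Ici a, ENNReal.ofReal (r ^ 2 * ‖F' r‖ ^ 2) := by
        refine add_le_add ?_ ?_
        · gcongr
          exact Icc_subset_Ici_self
        · gcongr
          exact h2.trans (lintegral_mono_set (Ici_subset_Ici.2 hab))
    _ = _ := by rw [← add_mul]; norm_num

theorem lintegral_Ici_rpow_mul_norm_sq_le (hγ : γ < 1) (ha : 0 < a) (hF : ContinuousOn F (Ici a))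
    (hd : ∀ r ∈ Ioi a, HasDerivAt F (F' r) r) (hF' : Measurable F') :
    ∫⁻ r in Ici a, ENNReal.ofReal (r ^ (γ - 2) * ‖F r‖ ^ 2) ≤
      ENNReal.ofReal (4 / (1 - γ) ^ 2 + 2 / (1 - γ)) *
        (ENNReal.ofReal (a ^ (γ - 1) * ‖F a‖ ^ 2) +
          ∫⁻ r in Ici a, ENNReal.ofReal (r ^ γ * ‖F' r‖ ^ 2)) := by
  have hδ : 0 < 1 - γ := by linarith
  set δ := 1 - γ with hδd
  have hqa : Measurable fun r => 4 / δ ^ 2 * (|r| ^ γ * ‖F' r‖ ^ 2) := by fun_prop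
  refine lintegral_Ici_le_of_forall_lintegral_Icc_le fun b hab => ?_
  have hFc : ContinuousOn F (Icc a b) := hF.mono Icc_subset_Ici_self
  have hpow : ∀ s : ℝ, ContinuousOn (fun r : ℝ => r ^ s) (Icc a b) := fun s r hr =>
    (Real.continuousAt_rpow_const r s (Or.inl (ha.trans_le hr.1).ne')).continuousWithinAt
  have h := lintegral_le_of_le_add_deriv (p := fun r => r ^ (γ - 2) * ‖F r‖ ^ 2)
    (q := fun r => 4 / δ ^ 2 * (|r| ^ γ * ‖F' r‖ ^ 2))
    (G := fun r => -(2 / δ) * (r ^ (γ - 1) * ‖F r‖ ^ 2))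
    (G' := fun r => -(2 / δ) * ((γ - 1) * r ^ (γ - 1 - 1) * ‖F r‖ ^ 2 +
      r ^ (γ - 1) * (2 * inner ℝ (F r) (F' r)))) hab
    (continuousOn_const.mul ((hpow _).mul (hFc.norm.pow 2)))
    (fun r hr => (((Real.hasDerivAt_rpow_const (Or.inl (ha.trans hr.1).ne')).mul
      (hd r hr.1).norm_sq).const_mul _))
    ((hpow _).mul (hFc.norm.pow 2))
    (fun r hr => by have := ha.trans_le hr.1; positivity) hqa (fun r => by positivity)
    fun r hr => ?_
  · refine h.trans ?_
    have hqe : ∫⁻ r in Icc a b, ENNReal.ofReal (4 / δ ^ 2 * (|r| ^ γ * ‖F' r‖ ^ 2)) =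
        ENNReal.ofReal (4 / δ ^ 2) *
          ∫⁻ r in Icc a b, ENNReal.ofReal (r ^ γ * ‖F' r‖ ^ 2) := by
      rw [← lintegral_const_mul _ (by fun_prop)]
      refine setLIntegral_congr_fun measurableSet_Icc fun r hr => ?_
      rw [abs_of_pos (ha.trans_le hr.1), ENNReal.ofReal_mul (by positivity)]
    have hGab : ENNReal.ofReal (-(2 / δ) * (b ^ (γ - 1) * ‖F b‖ ^ 2) -
        -(2 / δ) * (a ^ (γ - 1) * ‖F a‖ ^ 2)) ≤
        ENNReal.ofReal (2 / δ) * ENNReal.ofReal (a ^ (γ - 1) * ‖F a‖ ^ 2) := by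
      rw [← ENNReal.ofReal_mul (by positivity)]
      refine ENNReal.ofReal_le_ofReal ?_
      have : 0 ≤ (2 / δ) * (b ^ (γ - 1) * ‖F b‖ ^ 2) := by
        have := ha.trans_le hab; positivity
      linarith
    rw [hqe, mul_add, add_comm]
    refine add_le_add (hGab.trans ?_) ?_
    · gcongr
      exact le_add_of_nonneg_left (by positivity)
    · refine mul_le_mul' (ENNReal.ofReal_le_ofReal (le_add_of_nonneg_right (by positivity)))
        (lintegral_mono_set Icc_subset_Ici_self)
  · have hr0 : 0 < r := ha.trans hr.1
    rw [abs_of_pos hr0, show γ - 1 - 1 = γ - 2 by ring]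
    have e1 : r ^ (γ - 1) = r ^ (γ - 2) * r := by
      rw [← Real.rpow_add_one hr0.ne']; ring_nf
    have e2 : r ^ γ = r ^ (γ - 2) * r ^ 2 := by
      rw [← Real.rpow_natCast, ← Real.rpow_add hr0]; norm_num
    rw [e1, e2]
    have hw : 0 < r ^ (γ - 2) := Real.rpow_pos_of_pos hr0 _
    set w := r ^ (γ - 2)
    have h1 : inner ℝ (F r) (F' r) ≤ ‖F r‖ * ‖F' r‖ := real_inner_le_norm _ _
    have h2 : 0 ≤ w * (2 / δ * (r * ‖F' r‖) - ‖F r‖) ^ 2 := by positivity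
    have h3 : w * (4 / δ * r) * inner ℝ (F r) (F' r) ≤ w * (4 / δ * r) * (‖F r‖ * ‖F' r‖) := by
      gcongr
    have h4 : γ - 1 = -δ := by rw [hδd]; ring
    have h5 : 4 / δ ^ 2 * (w * r ^ 2 * ‖F' r‖ ^ 2) +
        -(2 / δ) * ((γ - 1) * w * ‖F r‖ ^ 2 + w * r * (2 * inner ℝ (F r) (F' r))) -
        w * ‖F r‖ ^ 2 = w * (2 / δ * (r * ‖F' r‖) - ‖F r‖) ^ 2 +
        (w * (4 / δ * r) * (‖F r‖ * ‖F' r‖) - w * (4 / δ * r) * inner ℝ (F r) (F' r)) := by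
      rw [h4]; field_simp; ring
    linarith
end Hardy

theorem dirD_eq_fderiv_add (A : V → Fin 4 → ℝ) (X : V) (φ : V → ℂ) (p : V) :
    dirD A X φ p = fderiv ℝ φ p X + Complex.I * ((∑ μ, X μ * A p μ : ℝ) : ℂ) * φ p := by
  have h := LinearMap.pi_apply_eq_sum_univ (fderiv ℝ φ p).toLinearMap X
  simp only [ContinuousLinearMap.coe_coe, Complex.real_smul] at h
  rw [h]
  simp only [dirD, covD, pdC, mul_add, Finset.sum_add_distrib, Complex.ofReal_sum,
    Complex.ofReal_mul, Finset.mul_sum, Finset.sum_mul]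
  congr 1
  · refine Finset.sum_congr rfl fun μ _ => ?_
    congr 3
    ext ν
    simp [Pi.single_apply, eq_comm]
  · exact Finset.sum_congr rfl fun μ _ => by ring

theorem measurable_covD {A : V → Fin 4 → ℝ} (hA : Measurable A) {φ : V → ℂ} (hφ : Measurable φ)
    (μ : Fin 4) : Measurable (covD A μ φ) := by
  have h1 : Measurable fun p => A p μ := hA.eval
  have h2 : Measurable (pdC μ φ) := measurable_fderiv_apply_const ℝ φ _
  have h3 : Measurable fun p => (A p μ : ℂ) := Complex.measurable_ofReal.comp h1
  exact h2.add ((measurable_const.mul h3).mul hφ)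

theorem measurable_dirD {A : V → Fin 4 → ℝ} (hA : Measurable A) {φ : V → ℂ} (hφ : Measurable φ)
    {X : V → V} (hX : Measurable X) : Measurable fun p => dirD A (X p) φ p :=
  Finset.measurable_sum _ fun μ _ =>
    (Complex.measurable_ofReal.comp hX.eval).mul (measurable_covD hA hφ μ)

theorem measurable_eD {A : V → Fin 4 → ℝ} (hA : Measurable A) {φ : V → ℂ} (hφ : Measurable φ) :
    Measurable (eD A φ) :=
  Finset.measurable_sum _ fun μ _ => (measurable_covD hA hφ μ).norm.pow_const 2

/-- Parallel transport along a straight line turns the covariant derivative into an ordinary one. -/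
theorem exists_gauge_along_line {A : V → Fin 4 → ℝ} (hA : Continuous A) {φ : V → ℂ}
    (hφ : Continuous φ) (p₀ X : V) :
    ∃ F F' : ℝ → ℂ, Continuous F ∧ Measurable F' ∧ (∀ s, ‖F s‖ = ‖φ (p₀ + s • X)‖) ∧
      (∀ s, ‖F' s‖ = ‖dirD A X φ (p₀ + s • X)‖) ∧
      ∀ s, DifferentiableAt ℝ φ (p₀ + s • X) → HasDerivAt F (F' s) s := by
  have hl : Continuous fun s : ℝ => p₀ + s • X := by fun_prop
  set α : ℝ → ℝ := fun s => ∑ μ, X μ * A (p₀ + s • X) μ with hα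
  have hαc : Continuous α := by fun_prop
  set a : ℝ → ℝ := fun s => ∫ x in (0 : ℝ)..s, α x with ha
  have had : ∀ s, HasDerivAt a (α s) s := fun s => hαc.integral_hasStrictDerivAt 0 s |>.hasDerivAt
  have hac : Continuous a := continuous_iff_continuousAt.2 fun s => (had s).continuousAt
  have hnorm : ∀ s, ‖Complex.exp (a s * Complex.I)‖ = 1 := fun s =>
    Complex.norm_exp_ofReal_mul_I _
  refine ⟨fun s => Complex.exp (a s * Complex.I) * φ (p₀ + s • X),
    fun s => Complex.exp (a s * Complex.I) * dirD A X φ (p₀ + s • X), by fun_prop, ?_,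
    fun s => by rw [norm_mul, hnorm, one_mul], fun s => by rw [norm_mul, hnorm, one_mul],
    fun s hs => ?_⟩
  · have h1 : Continuous fun s => Complex.exp (a s * Complex.I) := by fun_prop
    exact h1.measurable.mul
      ((measurable_dirD hA.measurable hφ.measurable measurable_const).comp hl.measurable)
  · have h1 : HasDerivAt (fun s => Complex.exp (a s * Complex.I))
        (Complex.exp (a s * Complex.I) * (α s * Complex.I)) s :=
      ((had s).ofReal_comp.mul_const Complex.I).cexp
    have h2 : HasDerivAt (fun s : ℝ => p₀ + s • X) X s := by
      simpa using ((hasDerivAt_id s).smul_const X).const_add p₀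
    have h3 := hs.hasFDerivAt.comp_hasDerivAt s h2
    refine (h1.mul h3).congr_deriv ?_
    simp only [Function.comp_def, dirD_eq_fderiv_add, hα]
    ring

theorem pt_eq_add_smul (c k r : ℝ) (ω : E3) : pt (c + k * r) r ω = pt c 0 ω + r • pt k 1 ω := by
  ext μ; fin_cases μ <;> simp [pt, mul_comm]

theorem rad_pt {t r : ℝ} {ω : E3} (hr : 0 ≤ r) (hω : ‖ω‖ = 1) : rad (pt t r ω) = r := by
  have hn : ‖ω‖ ^ 2 = 1 := by rw [hω]; norm_num
  rw [EuclideanSpace.norm_sq_eq, Fin.sum_univ_three] at hn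
  simp only [Real.norm_eq_abs, sq_abs] at hn
  have : ∑ i : Fin 3, (pt t r ω i.succ) ^ 2 = r ^ 2 := by
    simp only [Fin.sum_univ_three, pt]
    simp
    linear_combination r ^ 2 * hn
  rw [rad, this, Real.sqrt_sq hr]

theorem Lv_pt {t r : ℝ} {ω : E3} (hr : 0 < r) (hω : ‖ω‖ = 1) : Lv (pt t r ω) = pt 1 1 ω := by
  rw [Lv, rad_pt hr.le hω]
  ext μ; fin_cases μ <;> simp [pt, hr.ne']

theorem continuous_rad : Continuous rad := by unfold rad; fun_prop

theorem continuous_psi {φ : V → ℂ} (hφ : Continuous φ) : Continuous (psi φ) := by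
  have := continuous_rad
  unfold psi; fun_prop

theorem differentiableAt_psi {φ : V → ℂ} (hφ : Differentiable ℝ φ) {p : V} (hp : 0 < rad p) :
    DifferentiableAt ℝ (psi φ) p := by
  have h0 : (∑ i : Fin 3, (p i.succ) ^ 2) ≠ 0 := (Real.sqrt_pos.1 hp).ne'
  have h1 : DifferentiableAt ℝ rad p := by
    unfold rad
    exact DifferentiableAt.sqrt (by fun_prop) h0
  exact (Complex.ofRealCLM.differentiableAt.comp p h1).mul (hφ p)

theorem measurable_Lv : Measurable Lv := by
  have := continuous_rad.measurable
  refine measurable_pi_lambda _ fun μ => ?_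
  fin_cases μ <;> simp only [Lv] <;> simp <;> fun_prop

theorem norm_dirD_radial_sq_le (A : V → Fin 4 → ℝ) (φ : V → ℂ) (p : V) {ω : E3} (hω : ‖ω‖ = 1) :
    ‖dirD A (pt 0 1 ω) φ p‖ ^ 2 ≤ eD A φ p := by
  have hn : ‖ω‖ ^ 2 = 1 := by rw [hω]; norm_num
  rw [EuclideanSpace.norm_sq_eq, Fin.sum_univ_three] at hn
  simp only [Real.norm_eq_abs, sq_abs] at hn
  have h1 : ‖dirD A (pt 0 1 ω) φ p‖ ≤ ∑ μ, |pt 0 1 ω μ| * ‖covD A μ φ p‖ :=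
    (norm_sum_le _ _).trans (Finset.sum_le_sum fun μ _ => by
      rw [norm_mul, Complex.norm_real, Real.norm_eq_abs])
  have h2 := Finset.sum_mul_sq_le_sq_mul_sq Finset.univ (fun μ => |pt 0 1 ω μ|)
    (fun μ => ‖covD A μ φ p‖)
  have h3 : ∑ μ, |pt 0 1 ω μ| ^ 2 = 1 := by
    simp only [Fin.sum_univ_four, pt, sq_abs]
    simp
    linarith
  rw [h3, one_mul] at h2
  exact (pow_le_pow_left₀ (norm_nonneg _) h1 2).trans h2

theorem measurable_pt_cone (u : ℝ) : Measurable fun q : E3 × ℝ => pt (2 * u + q.2) q.2 q.1 := by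
  refine measurable_pi_lambda _ fun μ => ?_
  fin_cases μ <;> simp [pt] <;> fun_prop

theorem measurable_pt_slice (t : ℝ) : Measurable fun q : E3 × ℝ => pt t q.2 q.1 := by
  refine measurable_pi_lambda _ fun μ => ?_
  fin_cases μ <;> simp [pt] <;> fun_prop

/-- Polar form of an iterated integral over radii and directions. -/
theorem lintegral_sphLInt_swap {g : E3 × ℝ → ℝ≥0∞} (hg : Measurable g) (s : Set ℝ) :
    ∫⁻ r in s, sphLInt (fun ω => g (ω, r)) =
      ∫⁻ ω in sphere (0 : E3) 1, ∫⁻ r in s, g (ω, r) ∂volume ∂μH[2] := by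
  simp only [sphLInt]
  exact lintegral_lintegral_swap (hg.comp measurable_swap).aemeasurable

theorem lIntH_eq_lintegral_radius (u v₀ : ℝ) (f : V → ℝ) :
    lIntH u v₀ f = ∫⁻ r in Ici (v₀ - u), sphI f (2 * u + r) r := by
  have h := (measurePreserving_add_right (volume : Measure ℝ) u).setLIntegral_comp_preimage_emb
    (measurableEmbedding_addRight u) (fun v => sphI f (u + v) (v - u)) (Ici v₀)
  rw [lIntH, ← h]
  have hs : (fun r => r + u) ⁻¹' Ici v₀ = Ici (v₀ - u) := by
    ext r; simp
  rw [hs]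
  refine lintegral_congr fun r => ?_
  congr 1 <;> ring

theorem lIntH_eq_lintegral_sphere (u v₀ : ℝ) {f : V → ℝ} (hf : Measurable f) :
    lIntH u v₀ f = ∫⁻ ω in sphere (0 : E3) 1, ∫⁻ r in Ici (v₀ - u),
      oR (f (pt (2 * u + r) r ω)) ∂volume ∂μH[2] := by
  rw [lIntH_eq_lintegral_radius]
  exact lintegral_sphLInt_swap (g := fun q => oR (f (pt (2 * u + q.2) q.2 q.1)))
    (ENNReal.measurable_ofReal.comp (hf.comp (measurable_pt_cone u))) _

theorem measurable_lintegral_ray {g : E3 × ℝ → ℝ≥0∞} (hg : Measurable g) (s : Set ℝ) :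
    Measurable fun ω => ∫⁻ r in s, g (ω, r) :=
  Measurable.lintegral_prod_right' (ν := volume.restrict s) hg

theorem pt_cone_eq (u r : ℝ) (ω : E3) :
    pt (2 * u + r) r ω = pt (2 * u) 0 ω + r • pt 1 1 ω := by
  simpa using pt_eq_add_smul (2 * u) 1 r ω

theorem pt_slice_eq (t r : ℝ) (ω : E3) : pt t r ω = pt t 0 ω + r • pt 0 1 ω := by
  simpa using pt_eq_add_smul t 0 r ω

section Rays
variable {A : V → Fin 4 → ℝ} {φ : V → ℂ} {ω : E3} {u a : ℝ}

theorem tendsto_cone_of_vanishNullInf (hlim : vanishNullInf φ) (u : ℝ) (hω : ‖ω‖ = 1) :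
    Filter.Tendsto (fun r => φ (pt (2 * u + r) r ω)) Filter.atTop (nhds 0) := by
  refine ((hlim u ω hω).comp (Filter.tendsto_atTop_add_const_right _ u Filter.tendsto_id)).congr
    fun r => ?_
  simp only [Function.comp_apply, id_eq]
  congr 2 <;> ring

theorem lintegral_ray_rpow_le {γ : ℝ} (hγ : γ < 1) (hA : Continuous A) (hφ : Differentiable ℝ φ)
    (hω : ‖ω‖ = 1) (ha : 0 < a) :
    ∫⁻ r in Ici a, oR (rad (pt (2 * u + r) r ω) ^ γ * ‖φ (pt (2 * u + r) r ω)‖ ^ 2) ≤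
      oR (4 / (1 - γ) ^ 2 + 2 / (1 - γ)) *
        (oR (rad (pt (2 * u + a) a ω) ^ (1 + γ) * ‖φ (pt (2 * u + a) a ω)‖ ^ 2) +
          ∫⁻ r in Ici a, oR (rad (pt (2 * u + r) r ω) ^ γ *
            ‖dirD A (Lv (pt (2 * u + r) r ω)) (psi φ) (pt (2 * u + r) r ω)‖ ^ 2)) := by
  obtain ⟨F, F', hF, hF', hn, hn', hd⟩ := exists_gauge_along_line hA
    (continuous_psi hφ.continuous) (pt (2 * u) 0 ω) (pt 1 1 ω)
  simp only [← pt_cone_eq] at hn hn' hd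
  have hnr : ∀ r, 0 < r → ‖F r‖ = r * ‖φ (pt (2 * u + r) r ω)‖ := fun r hr => by
    rw [hn, psi, norm_mul, rad_pt hr.le hω, Complex.norm_real, Real.norm_of_nonneg hr.le]
  have h := lintegral_Ici_rpow_mul_norm_sq_le hγ ha hF.continuousOn
    (fun r hr => hd r (differentiableAt_psi hφ (by rw [rad_pt] <;> grind))) hF'
  have h1 : ∀ r : ℝ, 0 < r → ∀ s : ℝ, r ^ (s - 2) * r ^ 2 = r ^ s := fun r hr s => by
    rw [← Real.rpow_natCast, ← Real.rpow_add hr]; norm_num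
  refine (Eq.le ?_).trans (h.trans (Eq.le ?_))
  · refine setLIntegral_congr_fun measurableSet_Ici fun r hr => ?_
    have hr0 : 0 < r := ha.trans_le hr
    simp only [oR]
    rw [rad_pt hr0.le hω, hnr r hr0, mul_pow, ← mul_assoc, h1 r hr0]
  · have hb : a ^ (γ - 1) * ‖F a‖ ^ 2 = a ^ (1 + γ) * ‖φ (pt (2 * u + a) a ω)‖ ^ 2 := by
      rw [hnr a ha, mul_pow, ← mul_assoc, ← h1 a ha (1 + γ)]
      ring_nf
    rw [hb, rad_pt ha.le hω]
    congr 2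
    refine setLIntegral_congr_fun measurableSet_Ici fun r hr => ?_
    have hr0 : 0 < r := ha.trans_le hr
    simp only [oR]
    rw [rad_pt hr0.le hω, hn', Lv_pt hr0 hω]

theorem lintegral_ray_energy_eq (hω : ‖ω‖ = 1) (ha : 0 < a) {F' : ℝ → ℂ}
    (hn' : ∀ r, ‖F' r‖ = ‖dirD A (pt 1 1 ω) φ (pt (2 * u + r) r ω)‖) :
    ∫⁻ r in Ici a, ENNReal.ofReal (r ^ 2 * ‖F' r‖ ^ 2) =
      ∫⁻ r in Ici a, oR (eDL A φ (pt (2 * u + r) r ω) * rad (pt (2 * u + r) r ω) ^ 2) := by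
  refine setLIntegral_congr_fun measurableSet_Ici fun r hr => ?_
  have hr0 : 0 < r := ha.trans_le hr
  simp only [oR, eDL]
  rw [rad_pt hr0.le hω, hn', Lv_pt hr0 hω, mul_comm]

theorem lintegral_ray_norm_sq_le (hA : Continuous A) (hφ : Differentiable ℝ φ)
    (hlim : vanishNullInf φ) (hω : ‖ω‖ = 1) (ha : 0 < a) :
    ∫⁻ r in Ici a, oR (‖φ (pt (2 * u + r) r ω)‖ ^ 2) ≤
      6 * ∫⁻ r in Ici a,
        oR (eDL A φ (pt (2 * u + r) r ω) * rad (pt (2 * u + r) r ω) ^ 2) := by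
  obtain ⟨F, F', hF, hF', hn, hn', hd⟩ := exists_gauge_along_line hA
    hφ.continuous (pt (2 * u) 0 ω) (pt 1 1 ω)
  simp only [← pt_cone_eq] at hn hn' hd
  have h0 : Filter.Tendsto F Filter.atTop (nhds 0) := by
    rw [tendsto_zero_iff_norm_tendsto_zero]
    simpa [hn] using (tendsto_cone_of_vanishNullInf hlim u hω).norm
  have h := lintegral_Ici_norm_sq_le ha hF.continuousOn (fun r _ => hd r (hφ _)) hF' h0
  rw [lintegral_ray_energy_eq hω ha hn'] at h
  simpa only [hn, oR] using h

theorem mul_norm_sq_le_lintegral_ray (hA : Continuous A) (hφ : Differentiable ℝ φ)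
    (hlim : vanishNullInf φ) (hω : ‖ω‖ = 1) (ha : 0 < a) :
    oR (a * ‖φ (pt (2 * u + a) a ω)‖ ^ 2) ≤
      ∫⁻ r in Ici a, oR (eDL A φ (pt (2 * u + r) r ω) * rad (pt (2 * u + r) r ω) ^ 2) := by
  obtain ⟨F, F', hF, hF', hn, hn', hd⟩ := exists_gauge_along_line hA
    hφ.continuous (pt (2 * u) 0 ω) (pt 1 1 ω)
  simp only [← pt_cone_eq] at hn hn' hd
  have h0 : Filter.Tendsto F Filter.atTop (nhds 0) := by
    rw [tendsto_zero_iff_norm_tendsto_zero]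
    simpa [hn] using (tendsto_cone_of_vanishNullInf hlim u hω).norm
  have h := mul_norm_sq_le_lintegral_Ici ha hF.continuousOn (fun r _ => hd r (hφ _)) hF' h0
  rw [lintegral_ray_energy_eq hω ha hn'] at h
  simpa only [hn, oR] using h

theorem lintegral_radial_norm_sq_le (hA : Continuous A) (hφ : Differentiable ℝ φ) (t : ℝ)
    (hω : ‖ω‖ = 1) (ha : 0 ≤ a) :
    ∫⁻ r in Icc 0 a, oR (‖φ (pt t r ω)‖ ^ 2) ≤
      4 * (∫⁻ r in Icc 0 a, oR (r ^ 2) * oR (eD A φ (pt t r ω))) +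
        2 * oR (a * ‖φ (pt t a ω)‖ ^ 2) := by
  obtain ⟨F, F', hF, hF', hn, hn', hd⟩ := exists_gauge_along_line hA
    hφ.continuous (pt t 0 ω) (pt 0 1 ω)
  simp only [← pt_slice_eq] at hn hn' hd
  have h := lintegral_Icc_norm_sq_le le_rfl ha hF.continuousOn (fun r _ => hd r (hφ _)) hF'
  simp only [hn] at h
  refine h.trans ?_
  rw [← oR]
  gcongr with r
  rw [oR, oR, ← ENNReal.ofReal_mul (by positivity), hn']
  exact ENNReal.ofReal_le_ofReal (by gcongr; exact norm_dirD_radial_sq_le A φ _ hω)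

end Rays

section Flux
variable {A : V → Fin 4 → ℝ} {φ : V → ℂ}

theorem measurable_eDL_mul_rad_sq (hA : Measurable A) (hφ : Measurable φ) :
    Measurable fun p => eDL A φ p * rad p ^ 2 :=
  ((measurable_dirD hA hφ measurable_Lv).norm.pow_const 2).mul
    (continuous_rad.measurable.pow_const 2)

theorem lIntH_mono {f g : V → ℝ} (hfg : ∀ p, f p ≤ g p) (u v₀ : ℝ) :
    lIntH u v₀ f ≤ lIntH u v₀ g :=
  lintegral_mono fun _ => lintegral_mono fun _ => ENNReal.ofReal_le_ofReal (hfg _)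

theorem lIntH_eDL_le_EphiH (u v₀ : ℝ) :
    lIntH u v₀ (fun p => eDL A φ p * rad p ^ 2) ≤ EphiH A φ u v₀ :=
  lIntH_mono (fun p => mul_le_mul_of_nonneg_right
    (le_add_of_nonneg_right (by unfold eDslash; positivity)) (sq_nonneg _)) u v₀

theorem lIntH_rpow_mul_norm_sq_le {γ u v₀ : ℝ} (hγ : γ < 1) (hA : Continuous A)
    (hφ : Differentiable ℝ φ) (hv : 0 < v₀ - u) :
    lIntH u v₀ (fun p => rad p ^ γ * ‖φ p‖ ^ 2) ≤ oR (4 / (1 - γ) ^ 2 + 2 / (1 - γ)) *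
      (sphI (fun p => rad p ^ (1 + γ) * ‖φ p‖ ^ 2) (u + v₀) (v₀ - u) +
        lIntH u v₀ (fun p => rad p ^ γ * ‖dirD A (Lv p) (psi φ) p‖ ^ 2)) := by
  have hr := continuous_rad.measurable
  have hφm := hφ.continuous.measurable
  have hd := measurable_dirD hA.measurable (continuous_psi hφ.continuous).measurable measurable_Lv
  have hu : u + v₀ = 2 * u + (v₀ - u) := by ring
  have hb : Measurable fun ω => oR (rad (pt (2 * u + (v₀ - u)) (v₀ - u) ω) ^ (1 + γ) *
      ‖φ (pt (2 * u + (v₀ - u)) (v₀ - u) ω)‖ ^ 2) := by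
    have hp : Measurable fun ω : E3 => pt (2 * u + (v₀ - u)) (v₀ - u) ω :=
      (measurable_pt_cone u).comp (measurable_id.prodMk measurable_const)
    exact ENNReal.measurable_ofReal.comp
      (((hr.comp hp).pow_const _).mul ((hφm.comp hp).norm.pow_const 2))
  have hf : Measurable fun p => rad p ^ γ * ‖φ p‖ ^ 2 :=
    (hr.pow_const γ).mul (hφm.norm.pow_const 2)
  have hg : Measurable fun p => rad p ^ γ * ‖dirD A (Lv p) (psi φ) p‖ ^ 2 :=
    (hr.pow_const γ).mul (hd.norm.pow_const 2)
  rw [lIntH_eq_lintegral_sphere u v₀ hf, lIntH_eq_lintegral_sphere u v₀ hg, sphI, sphLInt, hu,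
    ← lintegral_add_left hb, ← lintegral_const_mul' (oR _) _ ENNReal.ofReal_ne_top]
  exact setLIntegral_mono' isClosed_sphere.measurableSet fun ω hω =>
    lintegral_ray_rpow_le hγ hA hφ (mem_sphere_zero_iff_norm.1 hω) hv

theorem lIntH_norm_sq_le {u v₀ : ℝ} (hA : Continuous A) (hφ : Differentiable ℝ φ)
    (hlim : vanishNullInf φ) (hv : 0 < v₀ - u) :
    lIntH u v₀ (fun p => ‖φ p‖ ^ 2) ≤ 6 * lIntH u v₀ (fun p => eDL A φ p * rad p ^ 2) := by
  have hφm := hφ.continuous.measurable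
  rw [lIntH_eq_lintegral_sphere u v₀ (hφm.norm.pow_const 2),
    lIntH_eq_lintegral_sphere u v₀ (measurable_eDL_mul_rad_sq hA.measurable hφm),
    ← lintegral_const_mul' _ _ (by simp)]
  exact setLIntegral_mono' isClosed_sphere.measurableSet fun ω hω =>
    lintegral_ray_norm_sq_le hA hφ hlim (mem_sphere_zero_iff_norm.1 hω) hv

theorem stp_smul (t r : ℝ) (ω : E3) : stp t (r • ω) = pt t r ω := by
  simp [stp, pt]

theorem measurable_stp (t : ℝ) : Measurable (stp t) := by
  refine measurable_pi_lambda _ fun μ => ?_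
  fin_cases μ <;> simp [stp] <;> fun_prop

theorem lintegral_sphI_norm_sq_le {K : ℝ≥0} {R τ : ℝ}
    (hK : ∀ f : E3 → ℝ≥0∞, Measurable f →
      ∫⁻ r in Icc 0 R, ENNReal.ofReal (r ^ 2) * sphLInt (fun ω => f (r • ω)) ≤
        K * ∫⁻ x in closedBall 0 R, f x)
    (hR : 0 < R) (hA : Continuous A) (hφ : Differentiable ℝ φ) (hlim : vanishNullInf φ) :
    ∫⁻ r in Icc 0 R, sphI (fun p => ‖φ p‖ ^ 2) τ r ≤ 4 * (K * lIntBall τ R (eD A φ)) +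
      2 * lIntH ((τ - R) / 2) ((τ + R) / 2) (fun p => eDL A φ p * rad p ^ 2) := by
  have hφm := hφ.continuous.measurable
  have hE := ENNReal.measurable_ofReal.comp (measurable_eD hA.measurable hφm)
  have hg : Measurable fun q : E3 × ℝ => oR (q.2 ^ 2) * oR (eD A φ (pt τ q.2 q.1)) :=
    (ENNReal.measurable_ofReal.comp (measurable_snd.pow_const 2)).mul
      (hE.comp (measurable_pt_slice τ))
  have hball : ∫⁻ ω in sphere (0 : E3) 1, ∫⁻ r in Icc 0 R,
      oR (r ^ 2) * oR (eD A φ (pt τ r ω)) ∂volume ∂μH[2] ≤ K * lIntBall τ R (eD A φ) := by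
    refine le_trans (Eq.le ?_) (hK _ (hE.comp (measurable_stp τ)))
    rw [← lintegral_sphLInt_swap hg]
    refine lintegral_congr fun r => ?_
    simp only [sphLInt, stp_smul]
    exact lintegral_const_mul' _ _ ENNReal.ofReal_ne_top
  have hu : (τ + R) / 2 - (τ - R) / 2 = R := by ring
  have hray : ∫⁻ ω in sphere (0 : E3) 1, oR (R * ‖φ (pt τ R ω)‖ ^ 2) ∂μH[2] ≤
      lIntH ((τ - R) / 2) ((τ + R) / 2) (fun p => eDL A φ p * rad p ^ 2) := by
    rw [lIntH_eq_lintegral_sphere _ _ (measurable_eDL_mul_rad_sq hA.measurable hφm), hu]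
    refine setLIntegral_mono' isClosed_sphere.measurableSet fun ω hω => ?_
    have h := mul_norm_sq_le_lintegral_ray (u := (τ - R) / 2) hA hφ hlim
      (mem_sphere_zero_iff_norm.1 hω) hR
    rwa [show 2 * ((τ - R) / 2) + R = τ by ring] at h
  calc ∫⁻ r in Icc 0 R, sphI (fun p => ‖φ p‖ ^ 2) τ r
      = ∫⁻ ω in sphere (0 : E3) 1, ∫⁻ r in Icc 0 R,
          oR (‖φ (pt τ r ω)‖ ^ 2) ∂volume ∂μH[2] :=
        lintegral_sphLInt_swap (g := fun q => oR (‖φ (pt τ q.2 q.1)‖ ^ 2))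
          (ENNReal.measurable_ofReal.comp
            ((hφm.comp (measurable_pt_slice τ)).norm.pow_const 2)) _
    _ ≤ ∫⁻ ω in sphere (0 : E3) 1,
          4 * (∫⁻ r in Icc 0 R, oR (r ^ 2) * oR (eD A φ (pt τ r ω))) +
            2 * oR (R * ‖φ (pt τ R ω)‖ ^ 2) ∂μH[2] :=
        setLIntegral_mono' isClosed_sphere.measurableSet fun ω hω =>
          lintegral_radial_norm_sq_le hA hφ τ (mem_sphere_zero_iff_norm.1 hω) hR.le
    _ ≤ _ := by
        rw [lintegral_add_left ((measurable_lintegral_ray hg _).const_mul 4),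
          lintegral_const_mul' _ _ (by simp), lintegral_const_mul' _ _ (by simp)]
        gcongr

theorem vStart_sub_pos {R : ℝ} (hR : 0 < R) (u : ℝ) : 0 < vStart R u - u := by
  unfold vStart; split_ifs <;> linarith

end Flux

end MKG

open MKG in
/-- **Hardy inequality.** For 0 ≤ γ < 1 and φ vanishing at null infinity,
∫_{H_u} r^γ|φ|² dv dω ≤ C(∫_{S²} r^{1+γ}|φ|²(u,v(u),ω) dω + ∫_{H_u} r^γ|D_L(rφ)|² dv dω),
and in particular ∫_{H_u}|φ|² dv dω ≤ C E[φ](H_u), ∫_{Σ_τ}|φ|² dv′dω ≤ C E[φ](Σ_τ). -/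
theorem statement2 (R : ℝ) (hR : 1 < R) (γ : ℝ) (hγ0 : 0 ≤ γ) (hγ1 : γ < 1) :
    ∃ C : ℝ, 0 < C ∧
      ∀ (A : V → Fin 4 → ℝ) (φ : V → ℂ), ContDiff ℝ (⊤ : ℕ∞) A → ContDiff ℝ (⊤ : ℕ∞) φ →
        vanishNullInf φ →
        ((∀ u : ℝ,
            lIntH u (vStart R u) (fun p => rad p ^ γ * ‖φ p‖ ^ 2)
              ≤ oR C *
                (sphI (fun p => rad p ^ (1 + γ) * ‖φ p‖ ^ 2)
                    (u + vStart R u) (vStart R u - u)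
                  + lIntH u (vStart R u)
                      (fun p => rad p ^ γ * ‖dirD A (Lv p) (psi φ) p‖ ^ 2)))
        ∧ (∀ u : ℝ,
            lIntH u (vStart R u) (fun p => ‖φ p‖ ^ 2) ≤ oR C * EphiH A φ u (vStart R u))
        ∧ (∀ τ : ℝ,
            lIntSig R τ (fun p => ‖φ p‖ ^ 2) ≤ oR C * EphiSig R A φ τ)) := by
  obtain ⟨K, hK⟩ := exists_lintegral_sphere_le_lintegral_closedBall
  have hR0 : 0 < R := by linarith
  have h1γ : 0 < 1 - γ := by linarith
  have hγC : 0 < 4 / (1 - γ) ^ 2 + 2 / (1 - γ) := by positivity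
  set C : ℝ := 4 / (1 - γ) ^ 2 + 2 / (1 - γ) + 8 + 4 * K with hC
  have hK0 : (0 : ℝ) ≤ K := K.coe_nonneg
  have hC8 : (8 : ℝ≥0∞) ≤ oR C := by
    rw [oR, ← ENNReal.ofReal_ofNat]
    exact ENNReal.ofReal_le_ofReal (by linarith)
  have hC6 : (6 : ℝ≥0∞) ≤ oR C := le_trans (by norm_num) hC8
  have hCK : (4 * K : ℝ≥0∞) ≤ oR C := by
    rw [oR, ← ENNReal.ofReal_coe_nnreal, ← ENNReal.ofReal_ofNat,
      ← ENNReal.ofReal_mul (by norm_num)]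
    exact ENNReal.ofReal_le_ofReal (by linarith)
  refine ⟨C, by linarith, fun A φ hA hφ hlim => ?_⟩
  have hAc := hA.continuous
  have hφd : Differentiable ℝ φ := hφ.differentiable (by simp)
  have hcone : ∀ u v₀, 0 < v₀ - u →
      lIntH u v₀ (fun p => ‖φ p‖ ^ 2) ≤ oR C * EphiH A φ u v₀ := fun u v₀ hv =>
    (lIntH_norm_sq_le hAc hφd hlim hv).trans (mul_le_mul' hC6 (lIntH_eDL_le_EphiH u v₀))
  refine ⟨fun u => ?_, fun u => hcone u _ (vStart_sub_pos hR0 u), fun τ => ?_⟩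
  · refine (lIntH_rpow_mul_norm_sq_le hγ1 hAc hφd (vStart_sub_pos hR0 u)).trans ?_
    gcongr
    exact ENNReal.ofReal_le_ofReal (by linarith)
  · unfold lIntSig EphiSig
    split_ifs with hτ
    · have h1 := lintegral_sphI_norm_sq_le (τ := τ) (hK R) hR0 hAc hφd hlim
      have h2 := lIntH_norm_sq_le (u := (τ - R) / 2) (v₀ := (τ + R) / 2) hAc hφd hlim
        (by linarith)
      have h3 := lIntH_eDL_le_EphiH (A := A) (φ := φ) ((τ - R) / 2) ((τ + R) / 2)
      calc _ ≤ _ := add_le_add h1 h2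
        _ = 4 * K * lIntBall τ R (eD A φ) + 8 *
            lIntH ((τ - R) / 2) ((τ + R) / 2) (fun p => eDL A φ p * rad p ^ 2) := by ring
        _ ≤ _ := by
          rw [mul_add]
          gcongr
    · exact hcone _ _ (by linarith)
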